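/- The function G_I is positive on (0,∞), and there exists a constant C > 0 such that for all integers n ≥ 1 and all integers k with 0 ≤ k < n, |(ν^I_{n,k} − λ_{n,k}²) − 2^k · G_I(2^{−k} n)| ≤ C. (That is, the variance of the internal profile of a random symmetric digital search tree satisfies Var(I_{n,k}) = 2^k G_I(2^{−k} n) + O(1) uniformly for 0 ≤ k < n.) -/

import Mathlib

open Filter Real

/-- `Q j = ∏_{ℓ=1}^{j} (1 - 2^{-ℓ})`. -/
noncomputable def Q (j : ℕ) : ℝ := ∏ l ∈ Finset.range j, (1 - (2:ℝ)^(-(l:ℤ)-1))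

/-- `Q_∞ = ∏_{ℓ≥1} (1 - 2^{-ℓ})`. -/
noncomputable def Qinf : ℝ := ∏' l : ℕ, (1 - (2:ℝ)^(-(l:ℤ)-1))

/-- Expected internal profile `λ_{n,k}`. -/
noncomputable def lam : ℕ → ℕ → ℝ
  | n, 0 => if n = 0 then 0 else 1
  | n, k + 1 => (2:ℝ)^((2:ℤ) - (n:ℤ)) *
      ∑ j ∈ Finset.range n, ((n-1).choose j : ℝ) * lam j k

/-- Second moment `ν^I_{n,k}` of the internal profile. -/
noncomputable def nuI : ℕ → ℕ → ℝ
  | n, 0 => if n = 0 then 0 else 1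
  | n, k + 1 => (2:ℝ)^((2:ℤ) - (n:ℤ)) *
      (∑ j ∈ Finset.range n, ((n-1).choose j : ℝ) * nuI j k)
    + (2:ℝ)^((2:ℤ) - (n:ℤ)) *
      (∑ j ∈ Finset.range n, ((n-1).choose j : ℝ) * lam j k * lam (n-1-j) k)

/-- `φ(u,v;x) = e^{-ux} ∫_0^x t e^{(u-v)t} dt`. -/
noncomputable def phi (u v x : ℝ) : ℝ :=
  Real.exp (-u * x) * ∫ t in (0:ℝ)..x, t * Real.exp ((u - v) * t)

/-- The function `G_I` describing the asymptotic variance of the internal profile. -/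
noncomputable def GI (x : ℝ) : ℝ :=
  ∑' j : ℕ, ∑' r : ℕ, ∑ h ∈ Finset.range (j+1), ∑ l ∈ Finset.range (j+1),
    (-1:ℝ)^(r+h+l) *
      (2:ℝ)^(-(j:ℤ) - (r.choose 2 : ℤ) - (h.choose 2 : ℤ) - (l.choose 2 : ℤ)
        + (h:ℤ) + (l:ℤ)) *
      phi ((2:ℝ)^(r+j)) ((2:ℝ)^h + (2:ℝ)^l) x /
      (Qinf * Q r * Q h * Q (j-h) * Q l * Q (j-l))


lemma Q_zero : Q 0 = 1 := by simp [Q]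

lemma Q_succ (j : ℕ) : Q (j+1) = Q j * (1 - 1 / 2^(j+1)) := by
  have : (2:ℝ)^(-(j:ℤ)-1) = 1 / 2^(j+1) := by
    rw [show -(j:ℤ)-1 = -((j+1:ℕ):ℤ) by push_cast; ring, zpow_neg, zpow_natCast, one_div]
  rw [Q, Finset.prod_range_succ, this]; rfl

lemma Q_lower (j : ℕ) : 1/4 + 1/2^(j+2) ≤ Q (j+1) := by
  induction j with
  | zero => rw [Q_succ, Q_zero]; norm_num
  | succ j ih =>
    rw [Q_succ]
    have h1 : (0:ℝ) < 1/2^(j+2) := by positivity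
    have h2 : (1:ℝ)/2^(j+2) ≤ 1/4 := by
      apply one_div_le_one_div_of_le (by norm_num)
      calc (4:ℝ) = 2^2 := by norm_num
        _ ≤ 2^(j+2) := pow_le_pow_right₀ (by norm_num) (by omega)
    have h3 : (1:ℝ)/2^(j+1+2) = 1/2^(j+2)/2 := by rw [pow_succ _ (j+2)]; field_simp
    have h4 : (1:ℝ)/2^(j+1+1) = 1/2^(j+2) := rfl
    rw [h3, h4]
    set e := (1:ℝ)/2^(j+2)
    calc _ ≤ (1/4+e)*(1-e) := by nlinarith
      _ ≤ _ := mul_le_mul_of_nonneg_right ih (by linarith)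

lemma Q_ge (j : ℕ) : 1/4 ≤ Q j := by
  cases j with
  | zero => rw [Q_zero]; norm_num
  | succ j => have := Q_lower j; have : (0:ℝ) < 1/2^(j+2) := by positivity
              linarith

lemma Q_pos (j : ℕ) : 0 < Q j := lt_of_lt_of_le (by norm_num) (Q_ge j)

lemma Q_succ_le (j : ℕ) : Q (j+1) ≤ Q j := by
  rw [Q_succ]
  have h1 : (0:ℝ) < 1/2^(j+1) := by positivity
  have := Q_pos j
  nlinarith

lemma Q_anti : Antitone Q := antitone_nat_of_succ_le Q_succ_le

lemma Q_le_one (j : ℕ) : Q j ≤ 1 := by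
  have := Q_anti (Nat.zero_le j); rwa [Q_zero] at this

lemma Q_mono' : Monotone (fun j => Q j - 1/2^j) := by
  apply monotone_nat_of_le_succ
  intro j
  have h1 : (0:ℝ) < 1/2^(j+1) := by positivity
  have h2 : (1:ℝ)/2^j = 2*(1/2^(j+1)) := by rw [pow_succ]; field_simp
  have := Q_le_one j
  show Q j - 1/2^j ≤ Q (j+1) - 1/2^(j+1)
  rw [Q_succ, h2]
  nlinarith

lemma Q_tendsto : Tendsto Q atTop (nhds Qinf) := by
  have hm : Multipliable (fun l : ℕ => 1 - (2:ℝ)^(-(l:ℤ)-1)) := by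
    have : (fun l : ℕ => 1 - (2:ℝ)^(-(l:ℤ)-1)) = fun l : ℕ => 1 + (-(1/2:ℝ)*(1/2)^l) := by
      ext l
      rw [show -(l:ℤ)-1 = -((l+1:ℕ):ℤ) by push_cast; ring, zpow_neg, zpow_natCast, pow_succ]
      simp; ring
    rw [this]
    apply multipliable_one_add_of_summable
    simp only [norm_mul, norm_pow]
    apply Summable.mul_left
    apply summable_geometric_of_lt_one (by norm_num) (by norm_num)
  exact hm.tendsto_prod_tprod_nat

lemma Qinf_le (j : ℕ) : Qinf ≤ Q j := Q_anti.le_of_tendsto Q_tendsto j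

lemma Qinf_ge' (j : ℕ) : Q j - 1/2^j ≤ Qinf := by
  have h : Tendsto (fun j => Q j - 1/2^j) atTop (nhds (Qinf - 0)) := by
    apply Q_tendsto.sub
    have := tendsto_pow_atTop_nhds_zero_of_lt_one (r := (1/2:ℝ)) (by norm_num) (by norm_num)
    simpa using this
  rw [sub_zero] at h
  exact Q_mono'.ge_of_tendsto h j

lemma Qinf_ge : 1/4 ≤ Qinf := ge_of_tendsto' Q_tendsto Q_ge

lemma Qinf_pos : 0 < Qinf := lt_of_lt_of_le (by norm_num) Qinf_ge

/-- partial fraction coefficients -/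
noncomputable def dd (h k : ℕ) : ℝ := (-1)^h / (2^(h.choose 2) * Q h * Q (k-h))

lemma dd_down (h k : ℕ) (hk : h ≤ k) : dd h (k+1) * (1 - 2^h/2^(k+1)) = dd h k := by
  unfold dd
  rw [Nat.succ_sub hk, Q_succ]
  have h1 : (2:ℝ)^h/2^(k+1) = 1/2^(k-h+1) := by
    rw [div_eq_div_iff (by positivity) (by positivity), ← pow_add, one_mul]; congr 1; omega
  rw [h1]
  have h2 : (1:ℝ) - 1/2^(k-h+1) ≠ 0 := by
    have : (1:ℝ)/2^(k-h+1) < 1 := by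
      rw [div_lt_one (by positivity)]; exact one_lt_pow₀ (by norm_num) (by omega)
    linarith
  have := (Q_pos h).ne'
  have := (Q_pos (k-h)).ne'
  rw [div_mul_eq_mul_div, div_eq_div_iff (by positivity) (by positivity)]
  ring

lemma dd_shift (h k : ℕ) : dd (h+1) (k+1) / 2^(h+1) * (1 - 2^(h+1)) = dd h k / 2^h := by
  unfold dd
  rw [Nat.succ_sub_succ, Q_succ, show (h+1).choose 2 = h.choose 2 + h by
    rw [Nat.choose_succ_succ' h 1]; simp; omega]
  have h2 : (2:ℝ)^(h+1) - 1 ≠ 0 := by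
    have : (1:ℝ) < 2^(h+1) := one_lt_pow₀ (by norm_num) (by omega)
    linarith
  have := (Q_pos h).ne'
  have := (Q_pos (k-h)).ne'
  have h3 : (1:ℝ) - 1/2^(h+1) = (2^(h+1) - 1)/2^(h+1) := by field_simp
  rw [h3]
  field_simp
  ring

lemma sum_dd_aux (k : ℕ) :
    (∑ h ∈ Finset.range (k+1), dd h k / 2^h = ∑ h ∈ Finset.range (k+2), dd h (k+1) / 2^h) ∧
    ∑ h ∈ Finset.range (k+2), dd h (k+1) = 0 := by
  set S := ∑ h ∈ Finset.range (k+2), dd h (k+1) / 2^h with hS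
  set U := ∑ h ∈ Finset.range (k+2), dd h (k+1) with hU
  have e1 : ∑ h ∈ Finset.range (k+1), dd h k / 2^h = S - U/2^(k+1) := by
    rw [hS, hU, Finset.sum_div, ← Finset.sum_sub_distrib, Finset.sum_range_succ _ (k+1)]
    rw [sub_self, add_zero]
    apply Finset.sum_congr rfl
    intro h hh
    rw [← dd_down h k (by simp at hh; omega)]
    field_simp
  have e2 : ∑ h ∈ Finset.range (k+1), dd h k / 2^h = S - U := by
    rw [hS, hU, ← Finset.sum_sub_distrib, Finset.sum_range_succ' _ (k+1)]
    simp only [pow_zero, div_one, sub_self, add_zero]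
    apply Finset.sum_congr rfl
    intro h hh
    rw [← dd_shift h k]
    field_simp
  have h3 : U * (1 - 1/2^(k+1)) = 0 := by
    have : U/2^(k+1) = U * (1/2^(k+1)) := by ring
    linarith
  have h2 : (1:ℝ) - 1/2^(k+1) ≠ 0 := by
    have : (1:ℝ)/2^(k+1) < 1 := by
      rw [div_lt_one (by positivity)]; exact one_lt_pow₀ (by norm_num) (by omega)
    linarith
  have h4 : U = 0 := by
    rcases mul_eq_zero.1 h3 with h | h
    · exact h
    · exact absurd h h2
  exact ⟨by rw [e2, h4, sub_zero], h4⟩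

lemma sum_dd (k : ℕ) : ∑ h ∈ Finset.range (k+2), dd h (k+1) = 0 := (sum_dd_aux k).2

lemma dd_zero_zero : dd 0 0 = 1 := by simp [dd, Q_zero]

lemma sum_cc (k : ℕ) : ∑ h ∈ Finset.range (k+1), dd h k / 2^h = 1 := by
  induction k with
  | zero => simp [dd_zero_zero]
  | succ k ih => rw [← (sum_dd_aux k).1, ih]

lemma choose_bd (h : ℕ) : (1:ℝ)/2^(h.choose 2) ≤ 8/4^h := by
  rw [div_le_div_iff₀ (by positivity) (by positivity), one_mul,
    show (8:ℝ) = 2^3 by norm_num, show (4:ℝ) = 2^2 by norm_num, ← pow_mul, ← pow_add]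
  apply pow_le_pow_right₀ (by norm_num)
  induction h with
  | zero => simp
  | succ h ih =>
    rcases Nat.lt_or_ge h 2 with h2 | h2
    · interval_cases h <;> simp
    · rw [Nat.choose_succ_succ' h 1]; simp; omega

lemma dd_abs (h k : ℕ) : |dd h k| ≤ 128/4^h := by
  unfold dd
  have h1 := Q_ge h
  have h2 := Q_ge (k-h)
  have p1 := Q_pos h
  have p2 := Q_pos (k-h)
  rw [abs_div, abs_pow, abs_neg, abs_one, one_pow, abs_of_pos (by positivity)]
  have e : 1/(2^(h.choose 2) * Q h * Q (k-h)) = 1/2^(h.choose 2) * (1/Q h) * (1/Q (k-h)) := by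
    field_simp
  rw [e]
  have i1 : 1/Q h ≤ 4 := by rw [div_le_iff₀ p1]; linarith
  have i2 : 1/Q (k-h) ≤ 4 := by rw [div_le_iff₀ p2]; linarith
  have i3 := choose_bd h
  calc 1/2^(h.choose 2) * (1/Q h) * (1/Q (k-h)) ≤ 8/4^h * 4 * 4 := by gcongr
    _ = _ := by ring

lemma geom_half (n : ℕ) : ∑ h ∈ Finset.range n, (1/2^h : ℝ) ≤ 2 := by
  have : ∀ n : ℕ, ∑ h ∈ Finset.range n, (1/2^h : ℝ) = 2 - 2/2^n := by
    intro n
    induction n with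
    | zero => simp
    | succ n ih => rw [Finset.sum_range_succ, ih, pow_succ]; field_simp; ring
  rw [this]
  have : (0:ℝ) < 2/2^n := by positivity
  linarith

lemma dd_abs2 (h k : ℕ) : |dd h k| * 2^h ≤ 128 * (1/2^h) := by
  have := dd_abs h k
  calc |dd h k| * 2^h ≤ 128/4^h * 2^h := by gcongr
    _ = _ := by rw [show (4:ℝ) = 2*2 by norm_num, mul_pow]; field_simp

lemma sum_dd_abs (n k : ℕ) : ∑ h ∈ Finset.range n, |dd h k| * 2^h ≤ 256 := by
  calc _ ≤ ∑ h ∈ Finset.range n, 128 * (1/2^h : ℝ) := Finset.sum_le_sum fun h _ => dd_abs2 h k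
    _ = 128 * ∑ h ∈ Finset.range n, (1/2^h : ℝ) := by rw [Finset.mul_sum]
    _ ≤ _ := by have := geom_half n; linarith

/-- symmetric binomial average -/
noncomputable def EB (n : ℕ) (f : ℕ → ℝ) : ℝ :=
  1/2^n * ∑ j ∈ Finset.range (n+1), (n.choose j : ℝ) * f j

lemma two_zpow_aux (n : ℕ) : (2:ℝ)^((2:ℤ) - ((n+1:ℕ):ℤ)) = 2 * (1/2^n) := by
  rw [show (2:ℤ) - ((n+1:ℕ):ℤ) = 1 - (n:ℤ) by push_cast; ring, zpow_sub₀ (by norm_num)]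
  simp; ring

lemma lam_zero (n : ℕ) : lam n 0 = if n = 0 then 0 else 1 := by
  unfold lam; rfl

lemma lam_zero' (k : ℕ) : lam 0 k = 0 := by
  cases k <;> simp [lam]

lemma lam_succ (n k : ℕ) : lam (n+1) (k+1) = 2 * EB n (fun j => lam j k) := by
  rw [lam, two_zpow_aux, EB]; simp; ring

lemma nu_zero (n : ℕ) : nuI n 0 = if n = 0 then 0 else 1 := by
  unfold nuI; rfl

lemma nu_zero' (k : ℕ) : nuI 0 k = 0 := by
  cases k <;> simp [nuI]

lemma nu_succ (n k : ℕ) : nuI (n+1) (k+1) =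
    2 * EB n (fun j => nuI j k) + 2 * EB n (fun j => lam j k * lam (n-j) k) := by
  rw [nuI, two_zpow_aux, EB, EB]; simp [mul_assoc]

lemma EB_pow2 (n : ℕ) (x y : ℝ) : EB n (fun j => x^j * y^(n-j)) = ((x+y)/2)^n := by
  rw [EB, div_pow, add_pow, Finset.mul_sum, Finset.sum_div]
  apply Finset.sum_congr rfl
  intro j _
  ring

lemma EB_pow (n : ℕ) (x : ℝ) : EB n (fun j => x^j) = ((x+1)/2)^n := by
  rw [← EB_pow2]; simp

lemma EB_sum {ι : Type*} (n : ℕ) (s : Finset ι) (f : ι → ℕ → ℝ) :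
    EB n (fun j => ∑ i ∈ s, f i j) = ∑ i ∈ s, EB n (f i) := by
  simp only [EB, Finset.mul_sum]
  rw [Finset.sum_comm]

lemma EB_mul (n : ℕ) (c : ℝ) (f : ℕ → ℝ) : EB n (fun j => c * f j) = c * EB n f := by
  simp only [EB, Finset.mul_sum]
  apply Finset.sum_congr rfl; intro j _; ring

lemma EB_add (n : ℕ) (f g : ℕ → ℝ) : EB n (fun j => f j + g j) = EB n f + EB n g := by
  simp only [EB, Finset.mul_sum, ← Finset.sum_add_distrib]
  apply Finset.sum_congr rfl; intro j _; ring

lemma EB_sub (n : ℕ) (f g : ℕ → ℝ) : EB n (fun j => f j - g j) = EB n f - EB n g := by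
  simp only [EB, Finset.mul_sum, ← Finset.sum_sub_distrib]
  apply Finset.sum_congr rfl; intro j _; ring

lemma EB_const (n : ℕ) (c : ℝ) : EB n (fun _ => c) = c := by
  have := EB_pow n 1
  have h2 := EB_mul n c (fun j => (1:ℝ)^j)
  simp at this h2
  rw [h2, this, mul_one]

lemma EB_mono (n : ℕ) (f g : ℕ → ℝ) (h : ∀ j ≤ n, f j ≤ g j) : EB n f ≤ EB n g := by
  unfold EB
  apply mul_le_mul_of_nonneg_left _ (by positivity)
  apply Finset.sum_le_sum
  intro j hj
  apply mul_le_mul_of_nonneg_left _ (by positivity)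
  exact h j (by simp at hj; omega)

lemma EB_refl (n : ℕ) (f : ℕ → ℝ) : EB n (fun j => f (n-j)) = EB n f := by
  unfold EB
  congr 1
  rw [← Finset.sum_range_reflect]
  apply Finset.sum_congr rfl
  intro j hj
  simp at hj
  show ((n.choose (n+1-1-j) : ℕ) : ℝ) * f (n - (n+1-1-j)) = _
  rw [show n + 1 - 1 - j = n - j by omega, show n - (n-j) = j by omega, Nat.choose_symm (by omega)]

lemma EB_succ (n : ℕ) (f : ℕ → ℝ) :
    EB (n+1) f = 1/2 * EB n f + 1/2 * EB n (fun j => f (j+1)) := by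
  unfold EB
  rw [Finset.sum_range_succ' _ (n+1)]
  simp only [Nat.choose_succ_succ', Nat.cast_add, add_mul, Finset.sum_add_distrib]
  have h := Finset.sum_range_succ' (fun j => (n.choose j : ℝ) * f j) (n+1)
  rw [Finset.sum_range_succ] at h
  simp at h
  simp
  rw [pow_succ, h]
  field_simp
  ring

lemma lam_formula (k n : ℕ) :
    lam n k = 2^k * (1 - ∑ h ∈ Finset.range (k+1), dd h k / 2^h * (1 - 2^h/2^k)^n) := by
  induction k generalizing n with
  | zero =>
    rw [lam_zero]
    cases n <;> simp [dd_zero_zero]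
  | succ k ih =>
    cases n with
    | zero =>
      rw [lam_zero']
      simp only [pow_zero, mul_one]
      rw [sum_cc]; simp
    | succ n =>
      rw [lam_succ]
      simp only [ih]
      rw [EB_mul, EB_sub, EB_const, EB_sum]
      simp only [EB_mul, EB_pow]
      rw [Finset.sum_range_succ _ (k+1)]
      have : (2:ℝ)^(k+1) ≠ 0 := by positivity
      rw [div_self this, sub_self, zero_pow (by omega), mul_zero, add_zero, ← mul_assoc, ← pow_succ']
      congr 2
      apply Finset.sum_congr rfl
      intro h hh
      rw [← dd_down h k (by simp at hh; omega)]
      have : ((1:ℝ) - 2^h/2^k + 1)/2 = 1 - 2^h/2^(k+1) := by rw [pow_succ]; field_simp; ring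
      rw [this]; ring

lemma lam_bd (n k : ℕ) : 0 ≤ lam n k ∧ lam n k ≤ 2^k := by
  induction k generalizing n with
  | zero => rw [lam_zero]; split_ifs <;> norm_num
  | succ k ih =>
    cases n with
    | zero => rw [lam_zero']; exact ⟨le_refl _, by positivity⟩
    | succ n =>
      rw [lam_succ]
      have h1 := EB_mono n (fun _ => 0) (fun j => lam j k) (fun j _ => (ih j).1)
      have h2 := EB_mono n (fun j => lam j k) (fun _ => 2^k) (fun j _ => (ih j).2)
      rw [EB_const] at h1 h2
      exact ⟨by linarith, by rw [pow_succ]; linarith⟩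

lemma nu_bd (n k : ℕ) : 0 ≤ nuI n k ∧ nuI n k ≤ 4^k := by
  induction k generalizing n with
  | zero => rw [nu_zero]; split_ifs <;> norm_num
  | succ k ih =>
    cases n with
    | zero => rw [nu_zero']; exact ⟨le_refl _, by positivity⟩
    | succ n =>
      rw [nu_succ]
      have h1 := EB_mono n (fun _ => 0) (fun j => nuI j k) (fun j _ => (ih j).1)
      have h2 := EB_mono n (fun j => nuI j k) (fun _ => 4^k) (fun j _ => (ih j).2)
      have h3 := EB_mono n (fun _ => 0) (fun j => lam j k * lam (n-j) k)
        (fun j _ => mul_nonneg (lam_bd j k).1 (lam_bd (n-j) k).1)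
      have h4 := EB_mono n (fun j => lam j k * lam (n-j) k) (fun _ => 2^k * 2^k)
        (fun j _ => mul_le_mul (lam_bd j k).2 (lam_bd (n-j) k).2 (lam_bd (n-j) k).1 (by positivity))
      rw [EB_const] at h1 h2 h3 h4
      have : (4:ℝ)^k = 2^k*2^k := by rw [← mul_pow]; norm_num
      exact ⟨by linarith, by rw [pow_succ]; linarith⟩


noncomputable def vv (n k : ℕ) : ℝ := nuI n k - (lam n k)^2

lemma binom_term_le (N i : ℕ) (hi : i ≤ N) (y : ℝ) (h0 : 0 ≤ y) (h1 : y ≤ 1) :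
    y^(N-i) * (1-y)^i * (N.choose i : ℝ) ≤ 1 := by
  have h := add_pow (1-y) y N
  have h2 : ∀ m ∈ Finset.range (N+1), 0 ≤ (1-y)^m * y^(N-m) * (N.choose m : ℝ) := by
    intro m _
    have : 0 ≤ 1 - y := by linarith
    positivity
  have h3 := Finset.single_le_sum h2 (show i ∈ Finset.range (N+1) by simp; omega)
  rw [← h] at h3
  simp at h3
  linarith

noncomputable def qf (n : ℕ) (y : ℝ) : ℝ := y^n * (1-y)^2
noncomputable def qf1 (n : ℕ) (y : ℝ) : ℝ := n * y^(n-1) * (1-y)^2 - 2 * y^n * (1-y)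
noncomputable def qf2 (n : ℕ) (y : ℝ) : ℝ :=
  n * (n-1:ℕ) * y^(n-1-1) * (1-y)^2 - 4 * n * y^(n-1) * (1-y) + 2 * y^n

lemma qf_deriv (n : ℕ) (y : ℝ) : HasDerivAt (qf n) (qf1 n y) y := by
  have h1 := hasDerivAt_pow n y
  have h2 := ((hasDerivAt_id y).const_sub 1).pow 2
  refine (h1.mul h2).congr_deriv ?_
  unfold qf1; simp; ring

lemma qf1_deriv (n : ℕ) (y : ℝ) : HasDerivAt (qf1 n) (qf2 n y) y := by
  have h1 := hasDerivAt_pow n y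
  have h3 := hasDerivAt_pow (n-1) y
  have h2 := ((hasDerivAt_id y).const_sub 1).pow 2
  have h4 := (hasDerivAt_id y).const_sub 1
  refine (((h3.const_mul (n:ℝ)).mul h2).sub ((h1.const_mul 2).mul h4)).congr_deriv ?_
  unfold qf2; simp; ring

lemma qf2_bd (n : ℕ) (y : ℝ) (h0 : 0 ≤ y) (h1 : y ≤ 1) : (n+4) * |qf2 n y| * (1-y) ≤ 64 := by
  have hy : 0 ≤ 1 - y := by linarith
  have b1 : (n+1) * n * (n-1:ℕ) * y^(n-1-1) * (1-y)^3 ≤ 6 := by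
    rcases Nat.lt_or_ge n 2 with h | h
    · interval_cases n <;> simp
    · have := binom_term_le (n+1) 3 (by omega) y h0 h1
      obtain ⟨m, rfl⟩ := Nat.exists_eq_add_of_le h
      have e : ((2+m+1).choose 3 : ℝ) * 6 = (2+m+1)*(2+m)*(m+1) := by
        have := Nat.descFactorial_eq_factorial_mul_choose (2+m+1) 3
        have h6 : (((2+m+1).descFactorial 3 : ℕ):ℝ) = 6 * ((2+m+1).choose 3 : ℝ) := by
          rw [this]; simp [Nat.factorial]
        rw [mul_comm, ← h6]
        simp [Nat.descFactorial, show 2 + m + 1 - 2 = m + 1 by omega]; ring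
      rw [show 2+m+1-3 = m by omega] at this
      rw [show 2+m-1-1 = m by omega, show 2+m-1 = m+1 by omega]
      push_cast
      calc _ = y^m * (1-y)^3 * (((2+m+1).choose 3 : ℝ) * 6) := by rw [e]; ring
        _ ≤ _ := by linarith
  have b2 : (n+1) * n * y^(n-1) * (1-y)^2 ≤ 2 := by
    rcases Nat.lt_or_ge n 1 with h | h
    · interval_cases n; simp
    · have := binom_term_le (n+1) 2 (by omega) y h0 h1
      rw [show n+1-2 = n-1 by omega, Nat.cast_choose_two] at this
      push_cast at this
      linarith
  have b3 : (n+1) * y^n * (1-y) ≤ 1 := by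
    have := binom_term_le (n+1) 1 (by omega) y h0 h1
    simp at this; linarith
  have hn : (n:ℝ) + 4 ≤ 4*(n+1) := by have : (0:ℝ) ≤ n := by positivity
                                      linarith
  have c1 : |qf2 n y| ≤ n * (n-1:ℕ) * y^(n-1-1) * (1-y)^2 + 4 * n * y^(n-1) * (1-y) + 2 * y^n := by
    have p1 : 0 ≤ n * (n-1:ℕ) * y^(n-1-1) * (1-y)^2 := by positivity
    have p2 : 0 ≤ 4 * n * y^(n-1) * (1-y) := by positivity
    have p3 : 0 ≤ 2 * y^n := by positivity
    unfold qf2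
    rw [abs_le]; constructor <;> linarith
  calc (n+4) * |qf2 n y| * (1-y) ≤ (4*(n+1)) * (n * (n-1:ℕ) * y^(n-1-1) * (1-y)^2
        + 4 * n * y^(n-1) * (1-y) + 2 * y^n) * (1-y) := by gcongr
    _ = 4 * ((n+1) * n * (n-1:ℕ) * y^(n-1-1) * (1-y)^3) + 16 * ((n+1) * n * y^(n-1) * (1-y)^2)
        + 8 * ((n+1) * y^n * (1-y)) := by ring
    _ ≤ 64 := by linarith

lemma second_diff (n : ℕ) (p s m : ℝ) (hs : 0 ≤ s) (hp : 0 ≤ p - s) (hm : 0 < m)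
    (hpm : p + s ≤ 1 - m) :
    (n+4) * |qf n (p+s) + qf n (p-s) - 2 * qf n p| ≤ 128 * s^2 / m := by
  have hn : (0:ℝ) < n + 4 := by positivity
  set M := 64 / (m * (n+4)) with hM
  have hM0 : 0 ≤ M := by positivity
  have hb : ∀ y ∈ Set.Icc (p-s) (p+s), ‖qf2 n y‖ ≤ M := by
    intro y hy
    have := qf2_bd n y (by linarith [hy.1]) (by linarith [hy.2])
    rw [hM, le_div_iff₀ (by positivity), Real.norm_eq_abs]
    calc |qf2 n y| * (m * (n+4)) = (n+4) * |qf2 n y| * m := by ring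
      _ ≤ (n+4) * |qf2 n y| * (1-y) := by gcongr; linarith [hy.2]
      _ ≤ 64 := this
  have h1 : ∀ t ∈ Set.Icc 0 s, ‖qf1 n (p+t) - qf1 n (p-t)‖ ≤ M * (2*s) := by
    intro t ht
    have := Convex.norm_image_sub_le_of_norm_hasDerivWithin_le (f := qf1 n) (f' := qf2 n)
      (s := Set.Icc (p-s) (p+s)) (x := p-t) (y := p+t)
      (fun x _ => (qf1_deriv n x).hasDerivWithinAt) hb (convex_Icc _ _)
      ⟨by linarith [ht.2], by linarith [ht.1]⟩ ⟨by linarith [ht.1], by linarith [ht.2]⟩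
    refine this.trans ?_
    rw [Real.norm_eq_abs, show p + t - (p-t) = 2*t by ring, abs_of_nonneg (by linarith [ht.1])]
    gcongr; exact ht.2
  have h2 := Convex.norm_image_sub_le_of_norm_hasDerivWithin_le
      (f := fun t => qf n (p+t) + qf n (p-t)) (f' := fun t => qf1 n (p+t) - qf1 n (p-t))
      (s := Set.Icc 0 s) (x := 0) (y := s)
      (fun t _ => by
        have e1 : HasDerivAt (fun t => qf n (p+t)) (qf1 n (p+t) * 1) t :=
          (qf_deriv n (p+t)).comp t ((hasDerivAt_id t).const_add p)
        have e2 : HasDerivAt (fun t => qf n (p-t)) (qf1 n (p-t) * (-1)) t :=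
          (qf_deriv n (p-t)).comp t ((hasDerivAt_id t).const_sub p)
        exact ((e1.add e2).congr_deriv (by ring)).hasDerivWithinAt) h1 (convex_Icc _ _)
      ⟨le_refl _, hs⟩ ⟨hs, le_refl _⟩
  simp only [add_zero, sub_zero, Real.norm_eq_abs, abs_of_nonneg hs] at h2
  rw [show qf n (p+s) + qf n (p-s) - 2 * qf n p = qf n (p+s) + qf n (p-s) - (qf n p + qf n p) by ring]
  calc _ ≤ (n+4) * (M * (2*s) * s) := by gcongr
    _ = _ := by rw [hM]; field_simp; ring

noncomputable def DD (n k : ℕ) : ℝ := 2 * 4^k * ∑ h ∈ Finset.range (k+1), ∑ l ∈ Finset.range (k+1),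
  (dd h k / 2^h) * (dd l k / 2^l) *
    (((1-2^h/2^(k+1))*(1-2^l/2^(k+1)) + (2^h/2^(k+1))*(2^l/2^(k+1)))^n
    + ((1-2^h/2^(k+1))*(1-2^l/2^(k+1)) - (2^h/2^(k+1))*(2^l/2^(k+1)))^n
    - 2 * ((1-2^h/2^(k+1))*(1-2^l/2^(k+1)))^n : ℝ)

lemma vv_succ (n k : ℕ) : vv (n+1) (k+1) = 2 * EB n (fun j => vv j k) + DD n k := by
  set Y : ℕ → ℝ := fun j => ∑ h ∈ Finset.range (k+1), dd h k / 2^h * (1 - 2^h/2^k)^j with hY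
  have hl : ∀ j, lam j k = 2^k * (1 - Y j) := fun j => lam_formula k j
  have e1 : EB n Y = ∑ h ∈ Finset.range (k+1), dd h k / 2^h * (1 - 2^h/2^(k+1))^n := by
    rw [hY, EB_sum]
    apply Finset.sum_congr rfl
    intro h _
    rw [EB_mul, EB_pow]
    congr 2
    rw [pow_succ]; field_simp; ring
  have e2 : EB n (fun j => Y j * Y j) = ∑ h ∈ Finset.range (k+1), ∑ l ∈ Finset.range (k+1),
      (dd h k / 2^h) * (dd l k / 2^l) *
      ((1-2^h/2^(k+1))*(1-2^l/2^(k+1)) + (2^h/2^(k+1))*(2^l/2^(k+1)))^n := by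
    simp only [hY, Finset.sum_mul_sum]
    rw [EB_sum]
    apply Finset.sum_congr rfl; intro h _
    rw [EB_sum]
    apply Finset.sum_congr rfl; intro l _
    have : (fun j => dd h k / 2^h * (1 - 2^h/2^k)^j * (dd l k / 2^l * (1 - 2^l/2^k)^j))
      = fun j => (dd h k / 2^h * (dd l k / 2^l)) * ((1 - 2^h/2^k) * (1 - 2^l/2^k))^j := by
      ext j; rw [mul_pow]; ring
    rw [this, EB_mul, EB_pow]
    congr 2
    rw [pow_succ]; field_simp; ring
  have e3 : EB n (fun j => Y j * Y (n-j)) = ∑ h ∈ Finset.range (k+1), ∑ l ∈ Finset.range (k+1),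
      (dd h k / 2^h) * (dd l k / 2^l) *
      ((1-2^h/2^(k+1))*(1-2^l/2^(k+1)) - (2^h/2^(k+1))*(2^l/2^(k+1)))^n := by
    simp only [hY, Finset.sum_mul_sum]
    rw [EB_sum]
    apply Finset.sum_congr rfl; intro h _
    rw [EB_sum]
    apply Finset.sum_congr rfl; intro l _
    have : (fun j => dd h k / 2^h * (1 - 2^h/2^k)^j * (dd l k / 2^l * (1 - 2^l/2^k)^(n-j)))
      = fun j => (dd h k / 2^h * (dd l k / 2^l)) * ((1 - 2^h/2^k)^j * (1 - 2^l/2^k)^(n-j)) := by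
      ext j; ring
    rw [this, EB_mul, EB_pow2]
    congr 2
    rw [pow_succ]; field_simp; ring
  have e4 : EB n Y * EB n Y = ∑ h ∈ Finset.range (k+1), ∑ l ∈ Finset.range (k+1),
      (dd h k / 2^h) * (dd l k / 2^l) * ((1-2^h/2^(k+1))*(1-2^l/2^(k+1)))^n := by
    rw [e1, Finset.sum_mul_sum]
    apply Finset.sum_congr rfl; intro h _
    apply Finset.sum_congr rfl; intro l _
    rw [mul_pow]; ring
  have hD : DD n k = 2 * 4^k * (EB n (fun j => Y j * Y j) + EB n (fun j => Y j * Y (n-j))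
      - 2 * (EB n Y * EB n Y)) := by
    rw [e2, e3, e4, DD, Finset.mul_sum (a := (2:ℝ)), ← Finset.sum_add_distrib, ← Finset.sum_sub_distrib]
    congr 1
    apply Finset.sum_congr rfl; intro h _
    rw [Finset.mul_sum (a := (2:ℝ)), ← Finset.sum_add_distrib, ← Finset.sum_sub_distrib]
    apply Finset.sum_congr rfl; intro l _
    ring
  have f1 : EB n (fun j => lam j k) = 2^k * (1 - EB n Y) := by
    simp only [hl]; rw [EB_mul, EB_sub, EB_const]
  have f2 : EB n (fun j => lam j k * lam (n-j) k) = 4^k * (1 - 2 * EB n Y + EB n (fun j => Y j * Y (n-j))) := by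
    have : (fun j => lam j k * lam (n-j) k)
      = fun j => 4^k * (((1 - Y j) - Y (n-j)) + Y j * Y (n-j)) := by
      ext j; rw [hl, hl, show (4:ℝ) = 2*2 by norm_num, mul_pow]; ring
    rw [this, EB_mul, EB_add, EB_sub, EB_sub, EB_const, EB_refl n Y]; ring
  have f3 : EB n (fun j => vv j k) = EB n (fun j => nuI j k) -
      4^k * (1 - 2 * EB n Y + EB n (fun j => Y j * Y j)) := by
    have : (fun j => vv j k)
      = fun j => nuI j k - 4^k * ((1 - 2 * Y j) + Y j * Y j) := by
      ext j; rw [vv, hl, show (4:ℝ)^k = 2^k*2^k by rw [← mul_pow]; norm_num]; ring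
    rw [this, EB_sub, EB_mul, EB_add, EB_sub, EB_const, EB_mul]
  rw [vv, nu_succ, lam_succ, hD, f3, f2, f1, show (4:ℝ) = 2*2 by norm_num, mul_pow]
  ring

lemma vv_zero (n : ℕ) : vv n 0 = 0 := by
  rw [vv, nu_zero, lam_zero]; split_ifs <;> norm_num

lemma vv_zero' (k : ℕ) : vv 0 k = 0 := by
  rw [vv, nu_zero', lam_zero']; norm_num

lemma DD_zero (k : ℕ) : DD 0 k = 0 := by
  unfold DD
  norm_num

lemma DD_one (k : ℕ) : DD 1 k = 0 := by
  unfold DD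
  rw [Finset.sum_eq_zero, mul_zero]
  intro h _
  apply Finset.sum_eq_zero
  intro l _
  ring

lemma EB_zero (f : ℕ → ℝ) : EB 0 f = f 0 := by simp [EB]

lemma vv_one (k : ℕ) : vv 1 k = 0 := by
  cases k with
  | zero => exact vv_zero 1
  | succ k => rw [vv_succ 0 k, EB_zero, vv_zero', DD_zero]; norm_num

lemma vv_two (k : ℕ) : vv 2 k = 0 := by
  cases k with
  | zero => exact vv_zero 2
  | succ k => rw [vv_succ 1 k, EB_succ, EB_zero, EB_zero, vv_zero', DD_one, vv_one]; norm_num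

lemma DD_bd (n k : ℕ) : (n+4) * |DD (n+2) k - 2 * DD (n+1) k + DD n k| ≤ 2^21/2^k := by
  have e : DD (n+2) k - 2 * DD (n+1) k + DD n k =
    2 * 4^k * ∑ h ∈ Finset.range (k+1), ∑ l ∈ Finset.range (k+1),
    (dd h k / 2^h) * (dd l k / 2^l) *
    (qf n ((1-2^h/2^(k+1))*(1-2^l/2^(k+1)) + (2^h/2^(k+1))*(2^l/2^(k+1)))
    + qf n ((1-2^h/2^(k+1))*(1-2^l/2^(k+1)) - (2^h/2^(k+1))*(2^l/2^(k+1)))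
    - 2 * qf n ((1-2^h/2^(k+1))*(1-2^l/2^(k+1))) : ℝ) := by
    unfold DD
    simp only [Finset.mul_sum]
    rw [← Finset.sum_sub_distrib, ← Finset.sum_add_distrib]
    apply Finset.sum_congr rfl; intro h _
    rw [← Finset.sum_sub_distrib, ← Finset.sum_add_distrib]
    apply Finset.sum_congr rfl; intro l _
    unfold qf
    ring
  have hterm : ∀ h ∈ Finset.range (k+1), ∀ l ∈ Finset.range (k+1),
    (n+4) * |(dd h k / 2^h) * (dd l k / 2^l) *
    (qf n ((1-2^h/2^(k+1))*(1-2^l/2^(k+1)) + (2^h/2^(k+1))*(2^l/2^(k+1)))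
    + qf n ((1-2^h/2^(k+1))*(1-2^l/2^(k+1)) - (2^h/2^(k+1))*(2^l/2^(k+1)))
    - 2 * qf n ((1-2^h/2^(k+1))*(1-2^l/2^(k+1))))| ≤
     (|dd h k| * 2^h) * (|dd l k| * 2^l) * (16 / 8^k) := by
    intro h hh l hl
    have key : ∀ h ∈ Finset.range (k+1), (1:ℝ)/2^(k+1) ≤ 2^h/2^(k+1) ∧ (2:ℝ)^h/2^(k+1) ≤ 1/2 := by
      intro h hh
      simp at hh
      constructor
      · gcongr; exact one_le_pow₀ (by norm_num)
      · rw [div_le_div_iff₀ (by positivity) (by norm_num), one_mul, ← pow_succ]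
        exact pow_le_pow_right₀ (by norm_num) (by omega)
    obtain ⟨a1, a2⟩ := key h hh
    obtain ⟨b1, b2⟩ := key l hl
    have hm : (0:ℝ) < 1/2^(k+1) := by positivity
    have sd := second_diff n ((1-2^h/2^(k+1))*(1-2^l/2^(k+1))) ((2^h/2^(k+1))*(2^l/2^(k+1))) (1/2^(k+1))
      (by positivity) (by nlinarith) hm (by nlinarith)
    rw [abs_mul, abs_mul, abs_div, abs_div, abs_of_pos (show (0:ℝ) < 2^h by positivity),
      abs_of_pos (show (0:ℝ) < 2^l by positivity)]
    calc _ = |dd h k| / 2^h * (|dd l k| / 2^l) * ((n+4) * |qf n ((1-2^h/2^(k+1))*(1-2^l/2^(k+1)) + (2^h/2^(k+1))*(2^l/2^(k+1)))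
        + qf n ((1-2^h/2^(k+1))*(1-2^l/2^(k+1)) - (2^h/2^(k+1))*(2^l/2^(k+1)))
        - 2 * qf n ((1-2^h/2^(k+1))*(1-2^l/2^(k+1)))|) := by ring
      _ ≤ |dd h k| / 2^h * (|dd l k| / 2^l) * (128 * ((2^h/2^(k+1))*(2^l/2^(k+1)))^2 / (1/2^(k+1))) := by
        gcongr
      _ = _ := by
        rw [show (8:ℝ)^k = 2^k*2^k*2^k by rw [← mul_pow, ← mul_pow]; norm_num, pow_succ (2:ℝ) k]
        field_simp
        ring
  rw [e, abs_mul, abs_of_pos (by positivity)]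
  calc _ = 2 * 4^k * ((n+4) * |∑ h ∈ Finset.range (k+1), ∑ l ∈ Finset.range (k+1),
    (dd h k / 2^h) * (dd l k / 2^l) *
    (qf n ((1-2^h/2^(k+1))*(1-2^l/2^(k+1)) + (2^h/2^(k+1))*(2^l/2^(k+1)))
    + qf n ((1-2^h/2^(k+1))*(1-2^l/2^(k+1)) - (2^h/2^(k+1))*(2^l/2^(k+1)))
    - 2 * qf n ((1-2^h/2^(k+1))*(1-2^l/2^(k+1))) : ℝ)|) := by ring
    _ ≤ 2 * 4^k * ∑ h ∈ Finset.range (k+1), ∑ l ∈ Finset.range (k+1),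
        (|dd h k| * 2^h) * (|dd l k| * 2^l) * (16 / 8^k) := by
      gcongr
      refine (mul_le_mul_of_nonneg_left ((Finset.abs_sum_le_sum_abs _ _).trans
        (Finset.sum_le_sum fun h _ => Finset.abs_sum_le_sum_abs _ _)) (by positivity)).trans ?_
      rw [Finset.mul_sum]
      apply Finset.sum_le_sum; intro h hh
      rw [Finset.mul_sum]
      apply Finset.sum_le_sum; intro l hl
      exact hterm h hh l hl
    _ = 2 * 4^k * (16/8^k) * ((∑ h ∈ Finset.range (k+1), |dd h k| * 2^h) *
        (∑ h ∈ Finset.range (k+1), |dd h k| * 2^h)) := by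
      rw [Finset.sum_mul_sum]
      simp only [Finset.mul_sum]
      apply Finset.sum_congr rfl; intro h _
      apply Finset.sum_congr rfl; intro l _
      ring
    _ ≤ 2 * 4^k * (16/8^k) * (256 * 256) := by
      have := sum_dd_abs (k+1) k
      gcongr
    _ = _ := by
      rw [show (8:ℝ) = 4*2 by norm_num, mul_pow]
      field_simp; norm_num

lemma EB_lin (n : ℕ) (α β : ℝ) : EB n (fun j => α * j + β) = α * n / 2 + β := by
  induction n generalizing β with
  | zero => rw [EB_zero]; simp
  | succ n ih =>
    rw [EB_succ, ih]
    have : (fun j : ℕ => α * ((j+1:ℕ):ℝ) + β) = fun j : ℕ => α * (j:ℝ) + (α + β) := by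
      ext j; push_cast; ring
    rw [this, ih]; push_cast; ring

lemma EB_inv1 (n : ℕ) : EB n (fun j => 1/((j:ℝ)+1)) ≤ 2/(n+1) := by
  have h1 : ∀ j ∈ Finset.range (n+1), (n.choose j : ℝ) * (1/((j:ℝ)+1)) = ((n+1).choose (j+1) : ℝ)/(n+1) := by
    intro j _
    have := Nat.add_one_mul_choose_eq n j
    have h2 : ((n:ℝ)+1) * (n.choose j) = ((n+1).choose (j+1) : ℝ) * (j+1) := by exact_mod_cast this
    field_simp
    linarith
  rw [EB, Finset.sum_congr rfl h1, ← Finset.sum_div]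
  have h3 : ∑ j ∈ Finset.range (n+1), ((n+1).choose (j+1) : ℝ) ≤ 2^(n+1) := by
    have := Nat.sum_range_choose (n+1)
    rw [Finset.sum_range_succ'] at this
    have h4 : (∑ j ∈ Finset.range (n+1), ((n+1).choose (j+1) : ℝ)) + 1 = 2^(n+1) := by
      simp at this
      exact_mod_cast this
    linarith
  calc _ ≤ 1/2^n * ((2:ℝ)^(n+1)/((n:ℝ)+1)) := by gcongr
    _ = _ := by rw [pow_succ]; field_simp

lemma EB_inv3 (n : ℕ) : EB n (fun j => 1/((j:ℝ)+3)) ≤ 2/(n+4) := by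
  set m : ℝ := (n+4)/2 with hm
  have hm0 : 0 < m := by positivity
  have h1 : ∀ j ≤ n, 1/((j:ℝ)+3) ≤ ((2-m)^2/m^2) * (1/((j:ℝ)+1)) + ((0:ℝ) * j + (1/m + 1/m^2 * (2 - m))) := by
    intro j _
    have hj : (0:ℝ) ≤ j := by positivity
    have : ((2-m)^2/m^2) * (1/((j:ℝ)+1)) + ((0:ℝ) * j + (1/m + 1/m^2 * (2 - m))) - 1/((j:ℝ)+3)
      = 2*(j+3-m)^2/(m^2*(j+1)*(j+3)) := by
      field_simp
      ring
    have h2 : 0 ≤ 2*(j+3-m)^2/(m^2*((j:ℝ)+1)*(j+3)) := by positivity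
    linarith
  refine (EB_mono n _ _ h1).trans ?_
  rw [EB_add, EB_mul, EB_lin]
  calc _ ≤ ((2-m)^2/m^2) * (2/(n+1)) + (0 * (n:ℝ) / 2 + (1/m + 1/m^2 * (2 - m))) := by
        gcongr; exact EB_inv1 n
    _ ≤ _ := by
      have hn : (0:ℝ) ≤ n := by positivity
      have : 2/((n:ℝ)+4) - (((2-m)^2/m^2) * (2/(n+1)) + (0 * (n:ℝ) / 2 + (1/m + 1/m^2 * (2 - m))))
        = 2 * n/ ((n+4)^2 * (n+1)) := by
        rw [hm]; field_simp; ring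
      have h2 : 0 ≤ 2 * n/ (((n:ℝ)+4)^2 * (n+1)) := by positivity
      linarith

lemma vv_diff2 (k n : ℕ) : |vv (n+2) k - 2 * vv (n+1) k + vv n k| ≤ 2^22 * (1 - 1/2^k) / (n+3) := by
  induction k generalizing n with
  | zero => simp [vv_zero]
  | succ k ih =>
    have hk : (0:ℝ) ≤ 1 - 1/2^k := by
      have : (1:ℝ)/2^k ≤ 1 := by
        rw [div_le_one (by positivity)]; exact one_le_pow₀ (by norm_num)
      linarith
    have hk1 : (0:ℝ) ≤ 1 - 1/2^(k+1) := by
      have : (1:ℝ)/2^(k+1) ≤ 1 := by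
        rw [div_le_one (by positivity)]; exact one_le_pow₀ (by norm_num)
      linarith
    cases n with
    | zero => rw [vv_two, vv_one, vv_zero', mul_zero, sub_zero, add_zero, abs_zero]; positivity
    | succ n =>
      have e : vv (n+1+2) (k+1) - 2 * vv (n+1+1) (k+1) + vv (n+1) (k+1) =
        1/2 * EB n (fun j => vv (j+2) k - 2 * vv (j+1) k + vv j k)
        + (DD (n+2) k - 2 * DD (n+1) k + DD n k) := by
        rw [show n+1+2 = (n+2)+1 by ring, vv_succ, vv_succ, vv_succ, EB_succ (n+1), EB_succ n, EB_succ n,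
          EB_add, EB_sub, EB_mul]
        ring
      have b1 : |EB n (fun j => vv (j+2) k - 2 * vv (j+1) k + vv j k)| ≤ 2^22 * (1 - 1/2^k) * (2/(n+4)) := by
        have hb : EB n (fun j => 2^22 * (1 - 1/2^k) * (1/((j:ℝ)+3))) ≤ 2^22 * (1 - 1/2^k) * (2/(n+4)) := by
          rw [EB_mul]
          exact mul_le_mul_of_nonneg_left (EB_inv3 n) (by positivity)
        rw [abs_le]
        constructor
        · have := EB_mono n (fun j => (-1) * (2^22 * (1 - 1/2^k) * (1/((j:ℝ)+3))))
            (fun j => vv (j+2) k - 2 * vv (j+1) k + vv j k) (fun j _ => by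
              have := (abs_le.1 (ih j)).1
              calc _ = -(2^22 * (1 - 1/2^k) / ((j:ℝ)+3)) := by ring
                _ ≤ _ := this)
          rw [EB_mul] at this
          linarith
        · have := EB_mono n
            (fun j => vv (j+2) k - 2 * vv (j+1) k + vv j k)
            (fun j => (2^22 * (1 - 1/2^k) * (1/((j:ℝ)+3)))) (fun j _ => by
              have := (abs_le.1 (ih j)).2
              calc _ ≤ _ := this
                _ = _ := by ring)
          linarith
      have b2 := DD_bd n k
      have b3 : |DD (n+2) k - 2 * DD (n+1) k + DD n k| ≤ 2^21/2^k / (n+4) := by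
        rw [le_div_iff₀ (by positivity)]; linarith
      rw [e]
      refine (abs_add_le _ _).trans ?_
      rw [abs_mul, abs_of_pos (show (0:ℝ) < 1/2 by norm_num)]
      calc _ ≤ 1/2 * (2^22 * (1 - 1/2^k) * (2/((n:ℝ)+4))) + 2^21/2^k / (n+4) := by gcongr
        _ = _ := by
          push_cast
          rw [pow_succ (2:ℝ) k]; field_simp; ring

lemma lam_diff2 (k n : ℕ) : |lam (n+2) k - 2 * lam (n+1) k + lam n k| ≤ 768 / (n+3) := by
  have e : lam (n+2) k - 2 * lam (n+1) k + lam n k =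
      - ∑ h ∈ Finset.range (k+1), dd h k * ((2^h/2^k) * (1 - 2^h/2^k)^n) := by
    simp only [lam_formula]
    have : ∀ n, ∑ h ∈ Finset.range (k+1), dd h k / 2^h * (1 - 2^h/2^k)^(n+2)
      - 2 * ∑ h ∈ Finset.range (k+1), dd h k / 2^h * (1 - 2^h/2^k)^(n+1)
      + ∑ h ∈ Finset.range (k+1), dd h k / 2^h * (1 - 2^h/2^k)^n
      = (∑ h ∈ Finset.range (k+1), dd h k * ((2^h/2^k) * (1 - 2^h/2^k)^n)) / 2^k := by
      intro n
      rw [Finset.mul_sum, ← Finset.sum_sub_distrib, ← Finset.sum_add_distrib, Finset.sum_div]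
      apply Finset.sum_congr rfl; intro h _
      have : (2:ℝ)^k ≠ 0 := by positivity
      have : (2:ℝ)^h ≠ 0 := by positivity
      generalize hy : (1:ℝ) - 2^h/2^k = y
      have hy2 : (2:ℝ)^h/2^k = 1 - y := by rw [← hy]; ring
      have hy3 : (2:ℝ)^h = 2^k * (1-y) := by rw [← hy2]; field_simp
      rw [hy2]
      rw [show dd h k / 2^h * y^(n+2) - 2 * (dd h k / 2^h * y^(n+1)) + dd h k / 2^h * y^n
        = dd h k / 2^h * (1-y)^2 * y^n by ring]
      field_simp
      rw [hy3]; ring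
    have h2 := this n
    have : (2:ℝ)^k ≠ 0 := by positivity
    rw [eq_div_iff this] at h2
    rw [← h2]; ring
  rw [e, abs_neg, le_div_iff₀ (by positivity)]
  refine (mul_le_mul_of_nonneg_right (Finset.abs_sum_le_sum_abs _ _) (by positivity)).trans ?_
  rw [Finset.sum_mul]
  calc _ ≤ ∑ h ∈ Finset.range (k+1), 3 * (|dd h k| * 2^h) := by
        apply Finset.sum_le_sum; intro h hh
        simp at hh
        have a1 : (2:ℝ)^h/2^k ≤ 1 := by
          rw [div_le_one (by positivity)]; exact pow_le_pow_right₀ (by norm_num) (by omega)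
        have a0 : (0:ℝ) ≤ 2^h/2^k := by positivity
        have := binom_term_le (n+1) 1 (by omega) (1 - 2^h/2^k) (by linarith) (by linarith)
        simp at this
        have hnn : 0 ≤ (1 - (2:ℝ)^h/2^k)^n := pow_nonneg (by linarith) _
        rw [abs_mul, abs_of_nonneg (show 0 ≤ (2:ℝ)^h/2^k * (1 - 2^h/2^k)^n by positivity)]
        have h1 : (1:ℝ) ≤ 2^h := one_le_pow₀ (by norm_num)
        have hn : (0:ℝ) ≤ n := by positivity
        have h3 : (2:ℝ)^h/2^k * (1 - 2^h/2^k)^n * (n+3) ≤ 3 := by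
          have : (2:ℝ)^h/2^k * (1 - 2^h/2^k)^n * (n+3) ≤ (2:ℝ)^h/2^k * (1 - 2^h/2^k)^n * (3*(n+1)) := by
            gcongr; linarith
          linarith
        calc _ = |dd h k| * ((2:ℝ)^h/2^k * (1 - 2^h/2^k)^n * (n+3)) := by ring
          _ ≤ |dd h k| * 3 := by gcongr
          _ ≤ 3 * (|dd h k| * 2^h) := by nlinarith [abs_nonneg (dd h k)]
    _ = 3 * ∑ h ∈ Finset.range (k+1), (|dd h k| * 2^h) := by rw [Finset.mul_sum]
    _ ≤ _ := by have := sum_dd_abs (k+1) k; linarith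


lemma hasSum_of_eq {f g : ℕ → ℝ} {a b : ℝ} (h : HasSum f a) (hf : ∀ m, g m = f m) (hb : b = a) :
    HasSum g b := by
  rw [hb, funext hf]; exact h

/-- Poisson weights -/
noncomputable def pw (z : ℝ) (m : ℕ) : ℝ := exp (-z) * (z^m / m.factorial)

noncomputable def PP (f : ℕ → ℝ) (z : ℝ) : ℝ := exp (-z) * ∑' m : ℕ, f m * (z^m / m.factorial)

lemma hasSum_exp' (z : ℝ) : HasSum (fun m : ℕ => z^m / m.factorial) (exp z) := by
  have := NormedSpace.expSeries_div_hasSum_exp (𝔸 := ℝ) z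
  rwa [← Real.exp_eq_exp_ℝ] at this

lemma summ_bdd (f : ℕ → ℝ) (K : ℝ) (hf : ∀ m, |f m| ≤ K) (z : ℝ) :
    Summable (fun m : ℕ => ‖f m * (z^m / m.factorial)‖) := by
  have h := ((Real.summable_pow_div_factorial |z|).mul_left K)
  refine Summable.of_nonneg_of_le (fun _ => norm_nonneg _) (fun m => ?_) h
  rw [norm_mul, Real.norm_eq_abs, Real.norm_eq_abs, abs_div, abs_pow, Nat.abs_cast]
  gcongr
  exact hf m

lemma PP_hasSum (f : ℕ → ℝ) (K : ℝ) (hf : ∀ m, |f m| ≤ K) (z : ℝ) :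
    HasSum (fun m => pw z m * f m) (PP f z) := by
  have := (summ_bdd f K hf z).of_norm.hasSum.mul_left (exp (-z))
  unfold PP pw
  exact hasSum_of_eq this (fun m => by ring) rfl

lemma pw_one (z : ℝ) : HasSum (fun m => pw z m) 1 := by
  have := (hasSum_exp' z).mul_left (exp (-z))
  rwa [← exp_add, neg_add_cancel, exp_zero] at this

lemma pw_nonneg (z : ℝ) (hz : 0 ≤ z) (m : ℕ) : 0 ≤ pw z m := by unfold pw; positivity

lemma pw_pow (z y : ℝ) : HasSum (fun m => pw z m * y^m) (exp (-((1-y)*z))) := by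
  have := (hasSum_exp' (y*z)).mul_left (exp (-z))
  rw [← exp_add, show -z + y*z = -((1-y)*z) by ring] at this
  exact hasSum_of_eq this (fun m => by unfold pw; rw [mul_pow]; ring) rfl

lemma pw_succ (z : ℝ) (m : ℕ) : pw z (m+1) * ((m:ℝ)+1) = z * pw z m := by
  unfold pw
  rw [Nat.factorial_succ, pow_succ]; push_cast; field_simp

lemma pw_shift (z : ℝ) (f : ℕ → ℝ) (s : ℝ) (h : HasSum (fun m => pw z m * f (m+1)) s) :
    HasSum (fun m => pw z m * (m * f m)) (z * s) := by
  have h2 : HasSum (fun m : ℕ => pw z (m+1) * (((m+1:ℕ):ℝ) * f (m+1))) (z * s) := by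
    refine hasSum_of_eq (h.mul_left z) (fun m => ?_) rfl
    rw [← mul_assoc, ← mul_assoc, ← pw_succ]; push_cast; ring
  have := (hasSum_nat_add_iff (f := fun m : ℕ => pw z m * (m * f m)) 1).1 h2
  simpa using this

lemma pw_m1 (z : ℝ) : HasSum (fun m => pw z m * (m:ℝ)) z := by
  have := pw_shift z (fun _ => 1) 1 (by simpa using pw_one z)
  simpa using this

lemma pw_m2 (z : ℝ) : HasSum (fun m => pw z m * (m:ℝ)^2) (z^2 + z) := by
  have := pw_shift z (fun m => (m:ℝ)) (z+1) (by
    convert (pw_m1 z).add (pw_one z) using 2 with m; push_cast; ring)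
  refine hasSum_of_eq (this) (fun m => ?_) ?_
  · ring
  · ring

lemma pw_m3 (z : ℝ) : HasSum (fun m => pw z m * (m:ℝ)^3) (z^3 + 3*z^2 + z) := by
  have := pw_shift z (fun m => (m:ℝ)^2) (z^2+z+2*z+1) (by
    convert ((pw_m2 z).add ((pw_m1 z).mul_left 2)).add (pw_one z) using 2 with m; push_cast; ring)
  refine hasSum_of_eq (this) (fun m => ?_) ?_
  · ring
  · ring

lemma pw_m4 (z : ℝ) : HasSum (fun m => pw z m * (m:ℝ)^4) (z^4 + 6*z^3 + 7*z^2 + z) := by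
  have := pw_shift z (fun m => (m:ℝ)^3) (z^3 + 3*z^2 + z + 3*(z^2+z)+3*z+1) (by
    convert (((pw_m3 z).add ((pw_m2 z).mul_left 3)).add ((pw_m1 z).mul_left 3)).add (pw_one z) using 2 with m
    push_cast; ring)
  refine hasSum_of_eq (this) (fun m => ?_) ?_
  · ring
  · ring

lemma pw_c1 (z : ℝ) : HasSum (fun m => pw z m * ((m:ℝ)-z)) 0 := by
  refine hasSum_of_eq ((pw_m1 z).sub ((pw_one z).mul_left z)) (fun m => ?_) ?_
  · ring
  · ring

lemma pw_c2 (z : ℝ) : HasSum (fun m => pw z m * ((m:ℝ)-z)^2) z := by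
  refine hasSum_of_eq (((pw_m2 z).sub ((pw_m1 z).mul_left (2*z))).add ((pw_one z).mul_left (z^2))) (fun m => ?_) ?_
  · ring
  · ring

lemma pw_c4 (z : ℝ) : HasSum (fun m => pw z m * ((m:ℝ)-z)^4) (3*z^2+z) := by
  refine hasSum_of_eq (((((pw_m4 z).sub ((pw_m3 z).mul_left (4*z))).add ((pw_m2 z).mul_left (6*z^2))).sub
    ((pw_m1 z).mul_left (4*z^3))).add ((pw_one z).mul_left (z^4))) (fun m => ?_) ?_
  · ring
  · ring

/-- discrete Taylor, upward -/
lemma taylor_up (f : ℕ → ℝ) (c : ℝ) (hf : ∀ i, |f (i+2) - 2 * f (i+1) + f i| ≤ c/(i+3))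
    (n i : ℕ) : |f (n+i+1) - f (n+i) - (f (n+1) - f n)| ≤ c/(n+2) * i ∧
      |f (n+i) - f n - i * (f (n+1) - f n)| ≤ c/(n+2) * i^2 := by
  have hc : 0 ≤ c := by
    have := (abs_nonneg _).trans (hf 0)
    simp at this; linarith
  induction i with
  | zero => simp
  | succ i ih =>
    obtain ⟨h1, h2⟩ := ih
    have h3 := hf (n+i)
    have h4 : c/((n+i:ℕ)+3) ≤ c/((n:ℝ)+2) := by
      push_cast
      gcongr
      · have : (0:ℝ) ≤ i := by positivity
        linarith
      · norm_num
    have hq : 0 ≤ c/((n:ℝ)+2) := by positivity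
    rw [show n+(i+1) = n+i+1 by ring]
    rw [show n+i+2 = n+i+1+1 by ring] at h3
    have hi : (0:ℝ) ≤ i := by positivity
    push_cast
    rw [abs_le] at h1 h2 h3
    constructor
    · rw [abs_le]; constructor <;> linarith [h1.1, h1.2, h3.1, h3.2]
    · rw [abs_le]; constructor <;> nlinarith [h1.1, h1.2, h2.1, h2.2, mul_nonneg hq hi]

/-- discrete Taylor, downward -/
lemma taylor_down (f : ℕ → ℝ) (c : ℝ) (hf : ∀ i, |f (i+2) - 2 * f (i+1) + f i| ≤ c/(i+3))
    (m i : ℕ) : |f m - f (m+i) + i * (f (m+i+1) - f (m+i))| ≤ c/(m+i+2) * i^2 := by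
  have hc : 0 ≤ c := by
    have := (abs_nonneg _).trans (hf 0)
    simp at this; linarith
  induction i with
  | zero => simp
  | succ i ih =>
    have h3 := hf (m+i)
    rw [show m+(i+1) = m+i+1 by ring]
    have e : f m - f (m+i+1) + ((i+1:ℕ):ℝ) * (f (m+i+1+1) - f (m+i+1)) =
      (f m - f (m+i) + i * (f (m+i+1) - f (m+i))) + (i+1) * (f (m+i+2) - 2 * f (m+i+1) + f (m+i)) := by
      push_cast; ring_nf
    rw [e]
    refine (abs_add_le _ _).trans ?_
    rw [abs_mul, abs_of_nonneg (show (0:ℝ) ≤ (i:ℝ)+1 by positivity)]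
    have hm : (0:ℝ) ≤ m := by positivity
    have hi : (0:ℝ) ≤ i := by positivity
    calc _ ≤ c/(m+i+2) * i^2 + (i+1) * (c/((m+i:ℕ)+3)) := by gcongr
      _ ≤ _ := by
        push_cast
        have : c/((m:ℝ)+(i+1)+2) * (i+1)^2 - (c/(m+i+2) * i^2 + (i+1) * (c/(m+i+3)))
          = c * (i * (m+2)) / ((m+i+2)*(m+i+3)) := by
          rw [show (m:ℝ)+(i+1)+2 = m+i+3 by ring]
          field_simp; ring
        have h2 : 0 ≤ c * (i * (m+2)) / (((m:ℝ)+i+2)*(m+i+3)) := by positivity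
        linarith

lemma taylor (f : ℕ → ℝ) (c : ℝ) (hf : ∀ i, |f (i+2) - 2 * f (i+1) + f i| ≤ c/(i+3))
    (n m : ℕ) : |f m - f n - ((m:ℝ)-n) * (f (n+1) - f n)| ≤ c/(n+2) * ((m:ℝ)-n)^2 := by
  rcases le_total n m with h | h
  · obtain ⟨i, rfl⟩ := Nat.exists_eq_add_of_le h
    have := (taylor_up f c hf n i).2
    push_cast
    rwa [show (n:ℝ)+i-n = i by ring]
  · obtain ⟨i, rfl⟩ := Nat.exists_eq_add_of_le h
    have := taylor_down f c hf m i
    push_cast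
    rwa [show (m:ℝ)-(m+i) = -i by ring, neg_sq, neg_mul, sub_neg_eq_add]

lemma PP_approx (f : ℕ → ℝ) (K c : ℝ) (hK : ∀ m, |f m| ≤ K)
    (hf : ∀ i, |f (i+2) - 2 * f (i+1) + f i| ≤ c/(i+3)) (n : ℕ) : |PP f n - f n| ≤ c := by
  have hc : 0 ≤ c := by
    have := (abs_nonneg _).trans (hf 0)
    simp at this; linarith
  have h1 : HasSum (fun m => pw n m * (f m - f n - ((m:ℝ)-n) * (f (n+1) - f n))) (PP f n - f n) := by
    refine hasSum_of_eq (((PP_hasSum f K hK n).sub ((pw_one n).mul_left (f n))).sub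
      ((pw_c1 n).mul_left (f (n+1) - f n))) (fun m => ?_) ?_
    · ring
    · ring
  have h2 : HasSum (fun m => pw n m * (c/(n+2) * ((m:ℝ)-n)^2)) (c/(n+2) * n) := by
    refine hasSum_of_eq ((pw_c2 n).mul_left (c/((n:ℝ)+2))) (fun m => ?_) rfl
    ring
  have h3 : |PP f n - f n| ≤ c/(n+2) * n := by
    rw [abs_le]
    constructor
    · refine hasSum_le (fun m => ?_) h2.neg h1
      have := (abs_le.1 (taylor f c hf n m)).1
      have hp := pw_nonneg n (by positivity) m
      nlinarith
    · refine hasSum_le (fun m => ?_) h1 h2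
      have := (abs_le.1 (taylor f c hf n m)).2
      have hp := pw_nonneg n (by positivity) m
      nlinarith
  refine h3.trans ?_
  rw [div_mul_eq_mul_div, div_le_iff₀ (by positivity)]
  nlinarith

lemma PP_var (f : ℕ → ℝ) (K c : ℝ) (hK : ∀ m, |f m| ≤ K)
    (hf : ∀ i, |f (i+2) - 2 * f (i+1) + f i| ≤ c/(i+3)) (n : ℕ) :
    |PP (fun m => f m ^ 2) n - (PP f n)^2 - n * (PP (fun m => f (m+1)) n - PP f n)^2| ≤ 3 * c^2 := by
  have hc : 0 ≤ c := by
    have := (abs_nonneg _).trans (hf 0)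
    simp at this; linarith
  set A := PP f n
  set B := PP (fun m => f m^2) n
  set A1 := PP (fun m => f (m+1)) n
  have hA : HasSum (fun m => pw n m * f m) A := PP_hasSum f K hK n
  have hA1 : HasSum (fun m => pw n m * f (m+1)) A1 := PP_hasSum (fun m => f (m+1)) K (fun m => hK _) n
  have hB : HasSum (fun m => pw n m * f m^2) B := PP_hasSum (fun m => f m^2) (K^2)
    (fun m => by rw [abs_pow]; exact pow_le_pow_left₀ (abs_nonneg _) (hK m) 2) n
  have hmA := pw_shift n f A1 hA1
  have S : ∀ α s : ℝ, HasSum (fun m => pw n m * (f m - α - ((m:ℝ)-n) * s)^2)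
      (B - 2*α*A - 2*s*n*(A1-A) + α^2 + n*s^2) := by
    intro α s
    refine hasSum_of_eq (((((hB.sub (hA.mul_left (2*α))).sub ((hmA.sub (hA.mul_left (n:ℝ))).mul_left (2*s))).add
      ((pw_one n).mul_left (α^2))).add ((pw_c2 n).mul_left (s^2))).add
      ((pw_c1 n).mul_left (2*α*s))) (fun m => ?_) ?_
    · ring
    · ring
  have hn : (0:ℝ) ≤ n := by positivity
  have l : 0 ≤ B - A^2 - n * (A1-A)^2 := by
    have h0 := (S A (A1-A)).nonneg (fun m => mul_nonneg (pw_nonneg n hn m) (sq_nonneg _))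
    nlinarith
  have u : B - A^2 - n * (A1-A)^2 ≤ (c/(n+2))^2 * (3*n^2+n) := by
    have h2 : HasSum (fun m => pw n m * (c/(n+2) * ((m:ℝ)-n)^2)^2) ((c/(n+2))^2 * (3*n^2+n)) := by
      refine hasSum_of_eq ((pw_c4 n).mul_left ((c/((n:ℝ)+2))^2)) (fun m => ?_) rfl
      ring
    have h3 := hasSum_le (fun m => ?_) (S (f n) (f (n+1) - f n)) h2
    · nlinarith [sq_nonneg (A - f n), mul_nonneg hn (sq_nonneg ((A1-A) - (f (n+1) - f n)))]
    · apply mul_le_mul_of_nonneg_left _ (pw_nonneg n hn m)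
      rw [← sq_abs (f m - f n - _)]
      exact pow_le_pow_left₀ (abs_nonneg _) (taylor f c hf n m) 2
  rw [abs_of_nonneg l]
  refine u.trans ?_
  rw [div_pow, div_mul_eq_mul_div, div_le_iff₀ (by positivity)]
  nlinarith [mul_nonneg (sq_nonneg c) hn]

lemma PP_mul (f g : ℕ → ℝ) (K L : ℝ) (hf : ∀ m, |f m| ≤ K) (hg : ∀ m, |g m| ≤ L) (z : ℝ) :
    PP (fun n => EB n (fun j => f j * g (n-j))) z = PP f (z/2) * PP g (z/2) := by
  unfold PP
  have h := tsum_mul_tsum_eq_tsum_sum_antidiagonal_of_summable_norm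
    (summ_bdd f K hf (z/2)) (summ_bdd g L hg (z/2))
  rw [show exp (-(z/2)) * (∑' m : ℕ, f m * ((z/2)^m / m.factorial)) *
    (exp (-(z/2)) * ∑' m : ℕ, g m * ((z/2)^m / m.factorial)) = (exp (-(z/2)) * exp (-(z/2))) *
    ((∑' m : ℕ, f m * ((z/2)^m / m.factorial)) * ∑' m : ℕ, g m * ((z/2)^m / m.factorial)) by ring, h,
    ← exp_add, show -(z/2) + -(z/2) = -z by ring]
  congr 1
  apply tsum_congr
  intro n
  simp only [EB]
  rw [Finset.Nat.sum_antidiagonal_eq_sum_range_succ_mk, Finset.mul_sum, Finset.sum_mul]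
  apply Finset.sum_congr rfl
  intro j hj
  have hj' : j ≤ n := by simp at hj; omega
  rw [Nat.cast_choose ℝ hj', div_pow, div_pow]
  have : (2:ℝ)^n = 2^j * 2^(n-j) := by rw [← pow_add]; congr 1; omega
  have h2 : z^n = z^j * z^(n-j) := by rw [← pow_add]; congr 1; omega
  rw [this, h2]
  field_simp

lemma PP_deriv (f : ℕ → ℝ) (K : ℝ) (hf : ∀ m, |f m| ≤ K) (z : ℝ) :
    HasDerivAt (PP f) (PP (fun m => f (m+1)) z - PP f z) z := by
  have hS : HasDerivAt (fun z : ℝ => ∑' m : ℕ, f m * (z^m / m.factorial))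
      (∑' m : ℕ, f m * ((m:ℝ) * z^(m-1) / m.factorial)) z := by
    have hK : 0 ≤ K := (abs_nonneg _).trans (hf 0)
    apply hasDerivAt_tsum_of_isPreconnected (t := Metric.ball (0:ℝ) (|z|+1)) (y₀ := 0)
      (g := fun (m:ℕ) (z:ℝ) => f m * (z^m / m.factorial)) (g' := fun (m:ℕ) (z:ℝ) => f m * ((m:ℝ) * z^(m-1) / m.factorial)) (u := fun m : ℕ => K * ((m:ℝ) * (|z|+1)^(m-1) / m.factorial))
    · apply Summable.mul_left
      rw [← summable_nat_add_iff 1]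
      refine (Real.summable_pow_div_factorial (|z|+1)).congr (fun m => ?_)
      simp only [Nat.add_sub_cancel]
      rw [Nat.factorial_succ]; push_cast; field_simp
    · exact Metric.isOpen_ball
    · exact (convex_ball _ _).isPreconnected
    · intro m y _
      exact ((hasDerivAt_pow m y).div_const _).const_mul _
    · intro m y hy
      simp at hy
      rw [norm_mul, Real.norm_eq_abs, Real.norm_eq_abs, abs_div, abs_mul, abs_pow, Nat.abs_cast, Nat.abs_cast]
      gcongr
      exact hf m
    · simp; positivity
    · exact (summ_bdd f K hf 0).of_norm
    · simp
  have hE : HasDerivAt (fun z : ℝ => exp (-z)) (exp (-z) * (-1)) z := ((hasDerivAt_id z).neg).exp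
  refine (hE.mul hS).congr_deriv ?_
  have : (∑' m : ℕ, f m * ((m:ℝ) * z^(m-1) / m.factorial)) = ∑' m : ℕ, f (m+1) * (z^m / m.factorial) := by
    have e : ∀ m : ℕ, f (m+1) * (((m+1:ℕ):ℝ) * z^(m+1-1) / (m+1).factorial) = f (m+1) * (z^m / m.factorial) := by
      intro m
      simp only [Nat.add_sub_cancel]
      rw [Nat.factorial_succ]; push_cast; field_simp
    have hs : Summable (fun m : ℕ => f m * ((m:ℝ) * z^(m-1) / m.factorial)) := by
      rw [← summable_nat_add_iff 1]
      simp only [e]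
      exact (summ_bdd (fun m => f (m+1)) K (fun m => hf _) z).of_norm
    rw [hs.tsum_eq_zero_add]
    simp only [e]
    simp
  rw [this]
  unfold PP; ring


noncomputable def FF (k : ℕ) (x : ℝ) : ℝ := 1 - ∑ h ∈ Finset.range (k+1), dd h k * (1/2^h * exp (-(2^h * x)))
noncomputable def F1 (k : ℕ) (x : ℝ) : ℝ := ∑ h ∈ Finset.range (k+1), dd h k * exp (-(2^h * x))
noncomputable def F2 (k : ℕ) (x : ℝ) : ℝ := ∑ h ∈ Finset.range (k+1), dd h k * (-2^h * exp (-(2^h * x)))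

lemma expd (c x : ℝ) : HasDerivAt (fun x : ℝ => exp (-(c * x))) (-c * exp (-(c*x))) x := by
  have := (((hasDerivAt_id x).const_mul c).neg).exp
  refine this.congr_deriv ?_
  simp; ring

lemma FF_deriv (k : ℕ) (x : ℝ) : HasDerivAt (FF k) (F1 k x) x := by
  have := (HasDerivAt.fun_sum (u := Finset.range (k+1)) (fun h _ =>
    ((expd ((2:ℝ)^h) x).const_mul (1/2^h)).const_mul (dd h k))).const_sub 1
  refine this.congr_deriv ?_
  unfold F1
  rw [← Finset.sum_neg_distrib]
  refine Finset.sum_congr rfl (fun h _ => ?_)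
  field_simp

lemma F1_deriv (k : ℕ) (x : ℝ) : HasDerivAt (F1 k) (F2 k x) x := by
  exact (HasDerivAt.fun_sum (u := Finset.range (k+1)) (fun h _ =>
    (expd ((2:ℝ)^h) x).const_mul (dd h k)))

lemma F2_cont (k : ℕ) : Continuous (F2 k) := by
  unfold F2; fun_prop

lemma dd_tel (k : ℕ) (w : ℕ → ℝ) :
    ∑ h ∈ Finset.range (k+2), dd h (k+1) * (1 - 2^h/2^(k+1)) * w h =
    ∑ h ∈ Finset.range (k+1), dd h k * w h := by
  rw [Finset.sum_range_succ, div_self (by positivity)]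
  simp only [sub_self, mul_zero, zero_mul, add_zero]
  refine Finset.sum_congr rfl (fun h hh => ?_)
  simp at hh
  rw [dd_down h k (by omega)]

lemma FF_rec (k : ℕ) (x : ℝ) : FF (k+1) x + F1 (k+1) x / 2^(k+1) = FF k x := by
  unfold FF F1
  rw [← dd_tel k, Finset.sum_div, show k+1+1 = k+2 by ring, sub_add, ← Finset.sum_sub_distrib]
  congr 1
  refine Finset.sum_congr rfl (fun h _ => ?_)
  field_simp

lemma F1_rec (k : ℕ) (x : ℝ) : F1 (k+1) x + F2 (k+1) x / 2^(k+1) = F1 k x := by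
  unfold F1 F2
  rw [← dd_tel k, Finset.sum_div, show k+1+1 = k+2 by ring, ← Finset.sum_add_distrib]
  refine Finset.sum_congr rfl (fun h _ => ?_)
  field_simp; ring

lemma FF_zero (k : ℕ) : FF k 0 = 0 := by
  have := sum_cc k
  unfold FF
  simp only [mul_zero, neg_zero, exp_zero, mul_one, mul_one_div]
  linarith

lemma F1_zero' (k : ℕ) : F1 (k+1) 0 = 0 := by
  have := sum_dd k
  unfold F1
  simpa using this

lemma FF0 (x : ℝ) : FF 0 x = 1 - exp (-x) := by simp [FF, dd_zero_zero]
lemma F10 (x : ℝ) : F1 0 x = exp (-x) := by simp [F1, dd_zero_zero]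
lemma F20 (x : ℝ) : F2 0 x = -exp (-x) := by simp [F2, dd_zero_zero]

lemma lam_abs (k m : ℕ) : |lam m k| ≤ 2^k := by
  rw [abs_of_nonneg (lam_bd m k).1]; exact (lam_bd m k).2
lemma nu_abs (k m : ℕ) : |nuI m k| ≤ 4^k := by
  rw [abs_of_nonneg (nu_bd m k).1]; exact (nu_bd m k).2

lemma PP_lam (k : ℕ) (z : ℝ) : PP (fun n => lam n k) z = 2^k * FF k (z/2^k) := by
  have h1 := PP_hasSum (fun n => lam n k) (2^k) (lam_abs k) z
  have h2 := ((pw_one z).sub (hasSum_sum (s := Finset.range (k+1)) (fun h _ =>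
    ((pw_pow z (1-2^h/2^k)).mul_left (dd h k/2^h))))).mul_left ((2:ℝ)^k)
  refine (h1.unique (hasSum_of_eq h2 (fun m => ?_) ?_)).trans rfl
  · rw [lam_formula, mul_comm (pw z m), mul_assoc, sub_mul, one_mul, Finset.sum_mul]
    congr 2
    refine Finset.sum_congr rfl (fun h _ => ?_)
    ring
  · unfold FF
    congr 2
    refine Finset.sum_congr rfl (fun h _ => ?_)
    rw [show 2^h * (z/2^k) = (1-(1-2^h/2^k))*z by ring]
    ring

lemma PP_lam1 (k : ℕ) (z : ℝ) : PP (fun n => lam (n+1) k) z - PP (fun n => lam n k) z = F1 k (z/2^k) := by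
  have h1 := PP_deriv (fun n => lam n k) (2^k) (lam_abs k) z
  have h2 : HasDerivAt (fun z : ℝ => 2^k * FF k (z/2^k)) (2^k * (F1 k (z/2^k) * (1/2^k))) z :=
    ((FF_deriv k (z/2^k)).comp z ((hasDerivAt_id z).div_const (2^k))).const_mul _
  rw [show PP (fun n => lam n k) = fun z => 2^k * FF k (z/2^k) from funext (PP_lam k)] at h1
  have := h1.unique h2
  rw [PP_lam k z, this]
  field_simp

lemma PP_one' (z : ℝ) : PP (fun _ => 1) z = 1 := by
  have h := PP_hasSum (fun _ => 1) 1 (by simp) z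
  exact h.unique (hasSum_of_eq (pw_one z) (fun m => by ring) rfl)

lemma PP_zero' (f : ℕ → ℝ) : PP f 0 = f 0 := by
  unfold PP
  rw [tsum_eq_single 0]
  · simp
  · intro m hm; simp [hm]

noncomputable def yy (k : ℕ) (x : ℝ) : ℝ := PP (fun n => nuI n k) (2^k*x)
noncomputable def y1 (k : ℕ) (x : ℝ) : ℝ := PP (fun n => nuI (n+1) k) (2^k*x)

lemma yy_deriv (k : ℕ) (x : ℝ) : HasDerivAt (yy k) (2^k*(y1 k x - yy k x)) x := by
  have h1 := (PP_deriv (fun n => nuI n k) (4^k) (nu_abs k) (2^k*x)).comp x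
    ((hasDerivAt_id x).const_mul ((2:ℝ)^k))
  refine h1.congr_deriv ?_
  unfold yy y1; ring

lemma y1_zero (x : ℝ) : y1 0 x = 1 := by
  unfold y1
  rw [← PP_one' (2^0*x)]
  congr 1

lemma PP_add (f g : ℕ → ℝ) (K L : ℝ) (hf : ∀ m, |f m| ≤ K) (hg : ∀ m, |g m| ≤ L) (a b z : ℝ) :
    PP (fun m => a * f m + b * g m) z = a * PP f z + b * PP g z := by
  unfold PP
  have h1 := (summ_bdd f K hf z).of_norm.hasSum
  have h2 := (summ_bdd g L hg z).of_norm.hasSum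
  have := hasSum_of_eq ((h1.mul_left a).add (h2.mul_left b))
    (g := fun m => (a * f m + b * g m) * (z^m/m.factorial)) (fun m => by ring) rfl
  rw [this.tsum_eq]; ring

lemma EB_abs (n : ℕ) (f : ℕ → ℝ) (K : ℝ) (hf : ∀ m, |f m| ≤ K) : |EB n f| ≤ K := by
  have hK := (abs_nonneg _).trans (hf 0)
  have h1 : EB n f ≤ EB n (fun _ => K) := EB_mono n _ _ (fun j _ => (abs_le.1 (hf j)).2)
  have h2 : EB n (fun _ => -K) ≤ EB n f := EB_mono n _ _ (fun j _ => (abs_le.1 (hf j)).1)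
  rw [EB_const] at h1 h2
  exact abs_le.2 ⟨h2, h1⟩

lemma y1_succ (k : ℕ) (x : ℝ) : y1 (k+1) x = 2 * yy k x + 2 * (2^k * FF k x)^2 := by
  unfold y1
  rw [show (fun n => nuI (n+1) (k+1)) = fun n => 2 * EB n (fun j => nuI j k * (fun _ => (1:ℝ)) (n-j)) +
    2 * EB n (fun j => lam j k * lam (n-j) k) from funext (fun n => by rw [nu_succ]; simp)]
  rw [PP_add _ _ (4^k) (4^k), PP_mul (fun j => nuI j k) (fun _ => 1) (4^k) 1 (nu_abs k) (by simp),
    PP_mul (fun j => lam j k) (fun j => lam j k) (2^k) (2^k) (lam_abs k) (lam_abs k), PP_one', PP_lam]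
  · unfold yy
    rw [show 2^(k+1)*x/2 = 2^k*x by ring, show 2^k*x/2^k = x by field_simp]; ring
  · intro m
    exact EB_abs _ _ _ (fun j => by simpa using nu_abs k j)
  · intro m
    refine EB_abs _ _ _ (fun j => ?_)
    rw [abs_mul, show (4:ℝ)^k = 2^k*2^k by rw [← mul_pow]; norm_num]
    exact mul_le_mul (lam_abs k j) (lam_abs k _) (abs_nonneg _) (by positivity)

noncomputable def gg (j : ℕ) (x : ℝ) : ℝ := x * (F2 j x)^2
lemma gg_cont (j : ℕ) : Continuous (gg j) := by
  have := F2_cont j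
  unfold gg; fun_prop

noncomputable def UU (k : ℕ) (x : ℝ) : ℝ := 1/2^k * (yy k x - 4^k * (FF k x)^2 - 2^k * (x * (F1 k x)^2))
noncomputable def U1 (k : ℕ) (x : ℝ) : ℝ := 1/2^k * (2^k*(y1 k x - yy k x) - 4^k * (2 * FF k x * F1 k x)
  - 2^k * ((F1 k x)^2 + x * (2 * F1 k x * F2 k x)))

lemma UU_deriv (k : ℕ) (x : ℝ) : HasDerivAt (UU k) (U1 k x) x := by
  have := (((yy_deriv k x).sub (((FF_deriv k x).pow 2).const_mul (4^k))).sub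
    (((hasDerivAt_id x).mul ((F1_deriv k x).pow 2)).const_mul (2^k))).const_mul (1/2^k)
  refine this.congr_deriv ?_
  unfold U1; simp

lemma UU_rec (k : ℕ) (x : ℝ) : UU (k+1) x + 1/2^(k+1) * U1 (k+1) x = UU k x + 1/4^(k+1) * gg (k+1) x := by
  unfold UU U1 gg
  rw [y1_succ, ← FF_rec k x, ← F1_rec k x]
  have h4 : (4:ℝ)^k = 2^k*2^k := by rw [← mul_pow]; norm_num
  rw [pow_succ 4, pow_succ 2, h4]
  have : (2:ℝ)^k ≠ 0 := by positivity
  field_simp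
  ring

lemma UU_zero (x : ℝ) : UU 0 x + U1 0 x = gg 0 x := by
  unfold UU U1 gg
  rw [y1_zero, FF0, F10, F20]
  ring

lemma UU_at (k : ℕ) : UU k 0 = 0 := by
  unfold UU yy
  rw [FF_zero, mul_zero, PP_zero', (show nuI 0 k = 0 from nu_zero' k)]
  simp

noncomputable def Ph (u : ℝ) (g : ℝ → ℝ) (x : ℝ) : ℝ := exp (-(u*x)) * ∫ t in (0:ℝ)..x, g t * exp (u*t)

lemma Ph_deriv (u : ℝ) (g : ℝ → ℝ) (hg : Continuous g) (x : ℝ) :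
    HasDerivAt (Ph u g) (g x - u * Ph u g x) x := by
  have hc : Continuous (fun t => g t * exp (u*t)) := by fun_prop
  have := (expd u x).mul (intervalIntegral.integral_hasDerivAt_right (hc.intervalIntegrable 0 x)
    (hc.stronglyMeasurableAtFilter _ _) hc.continuousAt)
  refine this.congr_deriv ?_
  unfold Ph
  have e : exp (-(u*x)) * exp (u*x) = 1 := by rw [← exp_add]; simp
  linear_combination g x * e

lemma Ph_at (u : ℝ) (g : ℝ → ℝ) : Ph u g 0 = 0 := by simp [Ph]

noncomputable def WW (k : ℕ) (x : ℝ) : ℝ := ∑ j ∈ Finset.range (k+1), 1/2^j *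
  ∑ r ∈ Finset.range (k-j+1), dd r (k-j) * Ph (2^(r+j)) (gg j) x
noncomputable def W1 (k : ℕ) (x : ℝ) : ℝ := ∑ j ∈ Finset.range (k+1), 1/2^j *
  ∑ r ∈ Finset.range (k-j+1), dd r (k-j) * (gg j x - 2^(r+j) * Ph (2^(r+j)) (gg j) x)

lemma WW_deriv (k : ℕ) (x : ℝ) : HasDerivAt (WW k) (W1 k x) x := by
  refine HasDerivAt.fun_sum (fun j _ => HasDerivAt.const_mul _ (HasDerivAt.fun_sum (fun r _ => ?_)))
  exact (Ph_deriv _ _ (gg_cont j) x).const_mul _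

lemma WW_at (k : ℕ) : WW k 0 = 0 := by simp [WW, Ph_at]

lemma WW_zero (x : ℝ) : WW 0 x + W1 0 x = gg 0 x := by
  simp [WW, W1, dd_zero_zero]

lemma WW_rec (k : ℕ) (x : ℝ) : WW (k+1) x + 1/2^(k+1) * W1 (k+1) x = WW k x + 1/4^(k+1) * gg (k+1) x := by
  unfold WW W1
  rw [Finset.sum_range_succ, Finset.sum_range_succ _ (k+1)]
  simp only [Nat.sub_self, zero_add, Finset.sum_range_one, dd_zero_zero, one_mul]
  have h4 : (4:ℝ)^(k+1) = 2^(k+1)*2^(k+1) := by rw [← mul_pow]; norm_num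
  have key : ∀ j ∈ Finset.range (k+1), 1/2^j *
      ∑ r ∈ Finset.range (k-j+1), dd r (k-j) * Ph (2^(r+j)) (gg j) x =
      1/2^j * (∑ r ∈ Finset.range (k+1-j+1), dd r (k+1-j) * Ph (2^(r+j)) (gg j) x) +
      1/2^(k+1) * (1/2^j * ∑ r ∈ Finset.range (k+1-j+1), dd r (k+1-j) * (gg j x - 2^(r+j) * Ph (2^(r+j)) (gg j) x)) := by
    intro j hj
    simp at hj
    obtain ⟨m, rfl⟩ : ∃ m, k = j + m := ⟨k-j, by omega⟩
    rw [show j+m-j = m by omega, show j+m+1-j = m+1 by omega, ← dd_tel m]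
    have h0 := sum_dd m
    have : ∑ r ∈ Finset.range (m+1+1), dd r (m+1) * (gg j x - 2^(r+j) * Ph (2^(r+j)) (gg j) x) =
      - ∑ r ∈ Finset.range (m+1+1), dd r (m+1) * (2^(r+j) * Ph (2^(r+j)) (gg j) x) := by
      simp only [mul_sub, Finset.sum_sub_distrib, ← Finset.sum_mul]
      rw [show m+1+1 = m+2 by ring, h0]; ring
    rw [this, show m+1+1 = m+2 by ring, ← Finset.sum_neg_distrib]
    simp only [Finset.mul_sum]
    rw [← Finset.sum_add_distrib]
    refine Finset.sum_congr rfl (fun r _ => ?_)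
    rw [show j+m+1 = j+(m+1) by ring, pow_add 2 r j, pow_add 2 j (m+1)]
    field_simp; ring
  rw [Finset.sum_congr rfl key, Finset.sum_add_distrib, ← Finset.mul_sum, h4]
  field_simp; ring

lemma ode_unique (A B A1 B1 : ℝ → ℝ) (c : ℝ) (hc : 0 < c) (hA : ∀ x, HasDerivAt A (A1 x) x)
    (hB : ∀ x, HasDerivAt B (B1 x) x) (h0 : A 0 = B 0) (h : ∀ x, A x + 1/c * A1 x = B x + 1/c * B1 x) (x : ℝ) :
    A x = B x := by
  have hd : ∀ x, HasDerivAt (fun x => exp (-(-c*x)) * (A x - B x)) 0 x := by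
    intro x
    refine ((expd (-c) x).mul ((hA x).sub (hB x))).congr_deriv ?_
    have h' : c * (A x - B x) + (A1 x - B1 x) = 0 := by
      have := h x
      field_simp at this; linarith
    simp only [neg_neg]
    simp only [Pi.sub_apply]
    linear_combination exp (-(-c*x)) * h'
  have := is_const_of_deriv_eq_zero (fun x => (hd x).differentiableAt) (fun x => (hd x).deriv) x 0
  simp only [h0, sub_self, mul_zero] at this
  have h2 := (mul_eq_zero.1 this).resolve_left (exp_pos _).ne'
  linarith

lemma UU_eq_WW (k : ℕ) : ∀ x, UU k x = WW k x := by
  induction k with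
  | zero =>
    refine ode_unique _ _ _ _ 1 one_pos (UU_deriv 0) (WW_deriv 0) (by rw [UU_at, WW_at]) (fun x => ?_)
    rw [div_one, one_mul, one_mul, UU_zero, WW_zero]
  | succ k ih =>
    refine ode_unique _ _ _ _ (2^(k+1)) (by positivity) (UU_deriv (k+1)) (WW_deriv (k+1)) (by rw [UU_at, WW_at]) (fun x => ?_)
    rw [UU_rec, WW_rec, ih]

lemma vv_WW (n k : ℕ) : |vv n k - 2^k * WW k (n/2^k)| ≤ 2^22 + 3 * 768^2 := by
  have e1 : 2^k * WW k (n/2^k) = PP (fun m => nuI m k) n - (PP (fun m => lam m k) n)^2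
      - n * (PP (fun m => lam (m+1) k) n - PP (fun m => lam m k) n)^2 := by
    rw [← UU_eq_WW, PP_lam1, PP_lam]
    unfold UU yy
    have h4 : (4:ℝ)^k = 2^k*2^k := by rw [← mul_pow]; norm_num
    rw [show (2:ℝ)^k*(n/2^k) = n by field_simp, h4]
    field_simp
  have hl2 : ∀ m, |lam m k^2| ≤ (2^k)^2 := fun m => by
    rw [abs_pow]; exact pow_le_pow_left₀ (abs_nonneg _) (lam_abs k m) 2
  have e2 : PP (fun m => vv m k) n = PP (fun m => nuI m k) n - PP (fun m => lam m k^2) n := by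
    have := PP_add (fun m => nuI m k) (fun m => lam m k^2) _ _ (nu_abs k) hl2 1 (-1) n
    rw [show (fun m => vv m k) = fun m => 1 * nuI m k + -1 * lam m k^2 from
      funext (fun m => by unfold vv; ring), this]
    ring
  have hp : 0 ≤ (1:ℝ)/2^k ∧ (1:ℝ)/2^k ≤ 1 := ⟨by positivity, by
    rw [div_le_one (by positivity)]; exact one_le_pow₀ (by norm_num)⟩
  have h1 := PP_approx (fun m => vv m k) (4^k + (2^k)^2) (2^22)
    (fun m => (abs_sub _ _).trans (add_le_add (nu_abs k m) (hl2 m)))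
    (fun i => (vv_diff2 k i).trans (by gcongr; nlinarith)) n
  have h2 := PP_var (fun m => lam m k) _ 768 (lam_abs k) (fun i => lam_diff2 k i) n
  rw [e1]
  rw [e2] at h1
  rw [abs_le] at h1 h2 ⊢
  constructor <;> linarith [h1.1, h1.2, h2.1, h2.2]


noncomputable def ee (r : ℕ) : ℝ := (-1)^r/(2^(r.choose 2) * Q r * Qinf)

lemma Ph_gg (u : ℝ) (j : ℕ) (x : ℝ) : Ph u (gg j) x = ∑ h ∈ Finset.range (j+1), ∑ l ∈ Finset.range (j+1),
    (dd h j * 2^h) * (dd l j * 2^l) * phi u (2^h + 2^l) x := by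
  have e : ∀ t, gg j t * exp (u*t) = ∑ h ∈ Finset.range (j+1), ∑ l ∈ Finset.range (j+1),
    (dd h j * 2^h) * (dd l j * 2^l) * (t * exp ((u - (2^h+2^l))*t)) := by
    intro t
    unfold gg F2
    rw [sq, Finset.sum_mul_sum, Finset.mul_sum, Finset.sum_mul]
    refine Finset.sum_congr rfl (fun h _ => ?_)
    rw [Finset.mul_sum, Finset.sum_mul]
    refine Finset.sum_congr rfl (fun l _ => ?_)
    rw [show (u - (2^h+2^l))*t = -(2^h*t) + -(2^l*t) + u*t by ring, exp_add, exp_add]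
    ring
  unfold Ph
  simp only [e]
  rw [intervalIntegral.integral_finsetSum, Finset.mul_sum]
  · refine Finset.sum_congr rfl (fun h _ => ?_)
    rw [intervalIntegral.integral_finsetSum, Finset.mul_sum]
    · refine Finset.sum_congr rfl (fun l _ => ?_)
      rw [intervalIntegral.integral_const_mul]
      unfold phi
      rw [neg_mul]; ring
    · intro l _
      exact Continuous.intervalIntegrable (by fun_prop) _ _
  · intro h _
    exact Continuous.intervalIntegrable (by fun_prop) _ _

noncomputable def TT (x : ℝ) (j r : ℕ) : ℝ := 1/2^j * (ee r * Ph (2^(r+j)) (gg j) x)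

lemma GI_eq (x : ℝ) : GI x = ∑' j : ℕ, ∑' r : ℕ, TT x j r := by
  unfold GI
  refine tsum_congr (fun j => tsum_congr (fun r => ?_))
  unfold TT
  rw [Ph_gg, Finset.mul_sum, Finset.mul_sum]
  refine Finset.sum_congr rfl (fun h _ => ?_)
  rw [Finset.mul_sum, Finset.mul_sum]
  refine Finset.sum_congr rfl (fun l _ => ?_)
  unfold ee dd
  rw [zpow_add₀ two_ne_zero, zpow_add₀ two_ne_zero, zpow_sub₀ two_ne_zero, zpow_sub₀ two_ne_zero,
    zpow_sub₀ two_ne_zero, zpow_neg]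
  simp only [zpow_natCast]
  have := (Q_pos r).ne'
  have := (Q_pos h).ne'
  have := (Q_pos l).ne'
  have := (Q_pos (j-h)).ne'
  have := (Q_pos (j-l)).ne'
  have := Qinf_pos.ne'
  rw [pow_add, pow_add]
  field_simp

lemma F2_bd (j : ℕ) (t : ℝ) (ht : 0 ≤ t) : |F2 j t| ≤ 256 * exp (-t) := by
  unfold F2
  refine (Finset.abs_sum_le_sum_abs _ _).trans ?_
  refine le_trans ?_ (mul_le_mul_of_nonneg_right (sum_dd_abs (j+1) j) (exp_pos _).le)
  rw [Finset.sum_mul]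
  refine Finset.sum_le_sum (fun h _ => ?_)
  rw [abs_mul, abs_mul, abs_neg, abs_pow, abs_two, abs_of_pos (exp_pos _), ← mul_assoc]
  gcongr
  have : (1:ℝ) ≤ 2^h := one_le_pow₀ (by norm_num)
  nlinarith

lemma gg_nonneg (j : ℕ) (t : ℝ) (ht : 0 ≤ t) : 0 ≤ gg j t := by unfold gg; positivity

lemma gg_bd (j : ℕ) (t : ℝ) (ht : 0 ≤ t) : gg j t ≤ 65536 := by
  unfold gg
  have h1 := F2_bd j t ht
  have h2 : (F2 j t)^2 ≤ (256 * exp (-t))^2 := by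
    rw [← sq_abs]; exact pow_le_pow_left₀ (abs_nonneg _) h1 2
  have h3 : t * exp (-t) ≤ 1 := by
    have h := add_one_le_exp t
    have : exp t * exp (-t) = 1 := by rw [← exp_add]; simp
    have := exp_pos (-t)
    nlinarith
  have h4 : exp (-t) ≤ 1 := exp_le_one_iff.2 (by linarith)
  have h5 := exp_pos (-t)
  calc t * (F2 j t)^2 ≤ t * (256 * exp (-t))^2 := by gcongr
    _ = 65536 * ((t * exp (-t)) * exp (-t)) := by ring
    _ ≤ 65536 * (1 * 1) := by gcongr
    _ = 65536 := by ring

lemma Ph_conv (u : ℝ) (g : ℝ → ℝ) (x : ℝ) : Ph u g x = ∫ t in (0:ℝ)..x, g t * exp (-(u*(x-t))) := by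
  unfold Ph
  rw [← intervalIntegral.integral_const_mul]
  congr 1; funext t
  rw [show -(u*(x-t)) = -(u*x) + u*t by ring, exp_add]; ring

lemma Ph_nonneg (u : ℝ) (j : ℕ) (x : ℝ) (hx : 0 ≤ x) : 0 ≤ Ph u (gg j) x := by
  unfold Ph
  refine mul_nonneg (exp_pos _).le (intervalIntegral.integral_nonneg hx (fun t ht => ?_))
  exact mul_nonneg (gg_nonneg j t ht.1) (exp_pos _).le

lemma Ph_bd (u : ℝ) (hu : 0 < u) (j : ℕ) (x : ℝ) (hx : 0 ≤ x) : Ph u (gg j) x ≤ 65536/u := by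
  have hg := gg_cont j
  have h1 : ∫ t in (0:ℝ)..x, gg j t * exp (u*t) ≤ ∫ t in (0:ℝ)..x, 65536 * exp (u*t) := by
    refine intervalIntegral.integral_mono_on hx (Continuous.intervalIntegrable (by fun_prop) _ _)
      (Continuous.intervalIntegrable (by fun_prop) _ _) (fun t ht => ?_)
    gcongr
    exact gg_bd j t ht.1
  have h2 : ∫ t in (0:ℝ)..x, 65536 * exp (u*t) = 65536/u * exp (u*x) - 65536/u := by
    rw [intervalIntegral.integral_eq_sub_of_hasDerivAt (f := fun t => 65536/u * exp (u*t))]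
    · simp
    · intro t _
      have := (((hasDerivAt_id t).const_mul u).exp).const_mul (65536/u)
      refine this.congr_deriv ?_
      simp; field_simp
    · exact (Continuous.intervalIntegrable (by fun_prop) _ _)
  unfold Ph
  rw [h2] at h1
  have e : exp (-(u*x)) * exp (u*x) = 1 := by rw [← exp_add]; simp
  have h3 := exp_pos (-(u*x))
  have h4 : 0 < 65536/u := by positivity
  calc _ ≤ exp (-(u*x)) * (65536/u * exp (u*x) - 65536/u) := by gcongr
    _ = 65536/u - exp (-(u*x)) * (65536/u) := by linear_combination 65536/u * e
    _ ≤ _ := by nlinarith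

lemma ee_base (r : ℕ) : |(-1:ℝ)^r/(2^(r.choose 2) * Q r)| ≤ 32/4^r := by
  have h := choose_bd r
  have hq := Q_ge r
  rw [abs_div, abs_pow, abs_neg, abs_one, one_pow, abs_of_pos (mul_pos (by positivity) (Q_pos r))]
  calc 1/((2:ℝ)^(r.choose 2) * Q r) = 1/2^(r.choose 2) * (1/Q r) := by field_simp
    _ ≤ 8/4^r * (1/(1/4)) := by gcongr
    _ = 32/4^r := by ring

lemma ee_bd (r : ℕ) : |ee r| ≤ 128/4^r := by
  have h := ee_base r
  have : ee r = (-1:ℝ)^r/(2^(r.choose 2) * Q r) * (1/Qinf) := by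
    unfold ee; have := Qinf_pos; field_simp
  rw [this, abs_mul, abs_of_pos (one_div_pos.2 Qinf_pos)]
  have hq := Qinf_ge
  calc _ ≤ 32/(4:ℝ)^r * (1/(1/4)) := by gcongr
    _ = _ := by ring

noncomputable def dh (k j r : ℕ) : ℝ := if j ≤ k ∧ r ≤ k - j then dd r (k-j) else 0

lemma dh_bd (k j r : ℕ) : |ee r - dh k j r| ≤ 512/2^r * (2^j/2^k) := by
  have h4 : (4:ℝ)^r = 2^r*2^r := by rw [← mul_pow]; norm_num
  have hb : |ee r| ≤ 512/2^r * (1/2^r) := (ee_bd r).trans (by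
    rw [h4, div_mul_div_comm, mul_one]; gcongr; norm_num)
  unfold dh
  split_ifs with hc
  · obtain ⟨hj, hr⟩ := hc
    obtain ⟨i, hi⟩ : ∃ i, k = j + r + i := ⟨k - j - r, by omega⟩
    subst hi
    have e1 : j + r + i - j = r + i := by omega
    have e2 : r + i - r = i := by omega
    have : ee r - dd r (j+r+i-j) = (-1:ℝ)^r/(2^(r.choose 2) * Q r) * ((Q i - Qinf)/(Qinf * Q i)) := by
      unfold ee dd
      rw [e1, e2]
      have := Qinf_pos.ne'
      have := (Q_pos i).ne'
      have := (Q_pos r).ne'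
      field_simp
    rw [this, abs_mul]
    have h1 := Qinf_le i
    have h2 := Qinf_ge' i
    have h3 := Qinf_ge
    have h5 := Q_ge i
    have hp := mul_pos Qinf_pos (Q_pos i)
    have h6 : |(Q i - Qinf)/(Qinf * Q i)| ≤ 16 * (1/2^i) := by
      rw [abs_of_nonneg (div_nonneg (by linarith) hp.le), div_le_iff₀ hp]
      have : (1:ℝ)/16 ≤ Qinf * Q i := by nlinarith
      have : (0:ℝ) < 1/2^i := by positivity
      nlinarith
    calc _ ≤ 32/4^r * (16 * (1/(2:ℝ)^i)) := mul_le_mul (ee_base r) h6 (abs_nonneg _) (by positivity)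
      _ = _ := by rw [h4, pow_add, pow_add]; field_simp; norm_num
  · rw [sub_zero]
    refine hb.trans (mul_le_mul_of_nonneg_left ?_ (by positivity))
    rw [div_le_div_iff₀ (by positivity) (by positivity), one_mul, ← pow_add]
    apply pow_le_pow_right₀ (by norm_num)
    omega

lemma geo2 : HasSum (fun r : ℕ => (1:ℝ)/2^r) 2 := by
  have := hasSum_geometric_two
  simpa using this

noncomputable def TH (x : ℝ) (k j r : ℕ) : ℝ := 1/2^j * (dh k j r * Ph (2^(r+j)) (gg j) x)

lemma WW_eq (x : ℝ) (k : ℕ) : WW k x = ∑' j : ℕ, ∑' r : ℕ, TH x k j r := by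
  rw [tsum_eq_sum (s := Finset.range (k+1))]
  · unfold WW
    refine Finset.sum_congr rfl (fun j hj => ?_)
    rw [tsum_eq_sum (s := Finset.range (k-j+1)), Finset.mul_sum]
    · refine Finset.sum_congr rfl (fun r hr => ?_)
      simp at hj hr
      unfold TH dh
      rw [if_pos ⟨by omega, by omega⟩]
    · intro r hr
      simp at hr
      unfold TH dh
      rw [if_neg (by omega)]; simp
  · intro j hj
    simp at hj
    have : ∀ r, TH x k j r = 0 := by
      intro r; unfold TH dh; rw [if_neg (by omega)]; simp
    simp [this]

lemma pow_four_le (r : ℕ) : (1:ℝ)/(2^r*2^r) ≤ 1/2^r := by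
  have : (1:ℝ) ≤ 2^r := one_le_pow₀ (by norm_num)
  gcongr; nlinarith

lemma term_bd (x : ℝ) (hx : 0 ≤ x) (j r : ℕ) (d B : ℝ) (hd : |d| ≤ B) :
    |1/2^j * (d * Ph (2^(r+j)) (gg j) x)| ≤ 65536 * B * (1/2^j * (1/2^j)) * (1/2^r) := by
  have hB := (abs_nonneg _).trans hd
  have h0 := Ph_nonneg (2^(r+j)) j x hx
  have h1 := Ph_bd (2^(r+j)) (by positivity) j x hx
  rw [abs_mul, abs_mul, abs_of_nonneg h0, abs_of_pos (by positivity)]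
  calc _ ≤ 1/(2:ℝ)^j * (B * (65536/2^(r+j))) := by gcongr
    _ = _ := by rw [pow_add]; field_simp

lemma TT_bd (x : ℝ) (hx : 0 ≤ x) (j r : ℕ) : |TT x j r| ≤ 65536 * 128 * (1/2^j) * (1/2^r) := by
  refine (term_bd x hx j r (ee r) 128 ((ee_bd r).trans ?_)).trans ?_
  · rw [div_le_iff₀ (by positivity)]
    have : (1:ℝ) ≤ 4^r := one_le_pow₀ (by norm_num)
    linarith
  · gcongr
    have := pow_four_le j
    rw [div_mul_div_comm, one_mul]; exact this

lemma diff_bd (x : ℝ) (hx : 0 ≤ x) (k j r : ℕ) :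
    |TT x j r - TH x k j r| ≤ 65536 * 512 * (1/2^k) * (1/2^j) * (1/2^r) := by
  have := term_bd x hx j r _ _ (dh_bd k j r)
  unfold TT TH
  rw [show 1/2^j * (ee r * Ph (2^(r+j)) (gg j) x) - 1/2^j * (dh k j r * Ph (2^(r+j)) (gg j) x)
    = 1/2^j * ((ee r - dh k j r) * Ph (2^(r+j)) (gg j) x) by ring]
  refine this.trans ?_
  calc _ = 65536 * 512 * (1/(2:ℝ)^k) * (1/2^j) * (1/(2^r*2^r)) := by field_simp
    _ ≤ _ := by
      have := pow_four_le r
      gcongr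

lemma TT_summ (x : ℝ) (hx : 0 ≤ x) (j : ℕ) : Summable (TT x j) :=
  Summable.of_norm_bounded (geo2.summable.mul_left (65536 * 128 * (1/2^j))) (TT_bd x hx j)

lemma TT_summ2 (x : ℝ) (hx : 0 ≤ x) : Summable (fun j => ∑' r, TT x j r) := by
  refine Summable.of_norm_bounded (geo2.summable.mul_left (65536 * 128 * 2)) (fun j => ?_)
  refine (tsum_of_norm_bounded (geo2.mul_left (65536 * 128 * (1/2^j))) (TT_bd x hx j)).trans ?_
  apply le_of_eq; ring

lemma TD_summ (x : ℝ) (hx : 0 ≤ x) (k j : ℕ) : Summable (fun r => TT x j r - TH x k j r) :=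
  Summable.of_norm_bounded (geo2.summable.mul_left (65536 * 512 * (1/2^k) * (1/2^j))) (diff_bd x hx k j)

lemma GI_WW (x : ℝ) (hx : 0 ≤ x) (k : ℕ) : |GI x - WW k x| ≤ 65536 * 512 * 4 * (1/2^k) := by
  have hb : ∀ j, ‖∑' r, (TT x j r - TH x k j r)‖ ≤ 65536 * 512 * (1/2^k) * 2 * (1/2^j) := fun j => by
    refine (tsum_of_norm_bounded (geo2.mul_left (65536 * 512 * (1/2^k) * (1/2^j))) (diff_bd x hx k j)).trans ?_
    apply le_of_eq; ring
  have hs : Summable (fun j => ∑' r, (TT x j r - TH x k j r)) :=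
    Summable.of_norm_bounded (geo2.summable.mul_left _) hb
  have hH : ∀ j, ∑' r, TH x k j r = ∑' r, TT x j r - ∑' r, (TT x j r - TH x k j r) := by
    intro j
    rw [← (TT_summ x hx j).tsum_sub (TD_summ x hx k j)]
    refine tsum_congr (fun r => by ring)
  rw [GI_eq, WW_eq]
  simp only [hH]
  rw [(TT_summ2 x hx).tsum_sub hs, sub_sub_cancel]
  refine (tsum_of_norm_bounded (geo2.mul_left (65536 * 512 * (1/2^k) * 2)) hb).trans ?_
  apply le_of_eq; ring

/-- positivity -/
noncomputable def eta (y : ℝ) : ℝ := ∑' r : ℕ, ee r * exp (-(2^r * y))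

lemma eta_term (y : ℝ) (hy : 0 ≤ y) (r : ℕ) : ‖ee r * exp (-(2^r*y))‖ ≤ 128 * (1/2^r) := by
  have h1 : exp (-(2^r*y)) ≤ 1 := exp_le_one_iff.2 (by
    have : 0 ≤ 2^r*y := by positivity
    linarith)
  rw [norm_mul, norm_eq_abs, norm_eq_abs, abs_of_pos (exp_pos _)]
  have h4 : (4:ℝ)^r = 2^r*2^r := by rw [← mul_pow]; norm_num
  have h2 := pow_four_le r
  have h3 := ee_bd r
  calc _ ≤ 128/(4:ℝ)^r * 1 := by gcongr
    _ = 128 * (1/(2^r*2^r)) := by rw [h4]; ring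
    _ ≤ _ := by gcongr

lemma eta_summ (y : ℝ) (hy : 0 ≤ y) : Summable (fun r : ℕ => ee r * exp (-(2^r * y))) :=
  Summable.of_norm_bounded (geo2.summable.mul_left 128) (eta_term y hy)

lemma F1_nonneg (m : ℕ) : ∀ y, 0 ≤ y → 0 ≤ F1 m y := by
  induction m with
  | zero => intro y _; rw [F10]; exact (exp_pos _).le
  | succ m ih =>
    intro y hy
    have hd : ∀ y, HasDerivAt (fun y => exp (-(-2^(m+1)*y)) * F1 (m+1) y)
        (2^(m+1) * exp (-(-2^(m+1)*y)) * F1 m y) y := by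
      intro y
      refine ((expd (-2^(m+1)) y).mul (F1_deriv (m+1) y)).congr_deriv ?_
      rw [← F1_rec m y]; field_simp
    have hm : MonotoneOn (fun y => exp (-(-2^(m+1)*y)) * F1 (m+1) y) (Set.Ici 0) := by
      apply monotoneOn_of_deriv_nonneg (convex_Ici 0)
      · exact fun y _ => (hd y).continuousAt.continuousWithinAt
      · exact fun y _ => (hd y).differentiableAt.differentiableWithinAt
      · intro y hy
        simp at hy
        rw [(hd y).deriv]
        have := ih y hy.le
        positivity
    have := hm (Set.mem_Ici.2 le_rfl) (Set.mem_Ici.2 hy) hy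
    simp only [F1_zero', mul_zero] at this
    exact nonneg_of_mul_nonneg_right this (exp_pos _)

lemma eta_nonneg (y : ℝ) (hy : 0 ≤ y) : 0 ≤ eta y := by
  have hF : ∀ m, F1 m y = ∑' r : ℕ, dh m 0 r * exp (-(2^r*y)) := by
    intro m
    rw [tsum_eq_sum (s := Finset.range (m+1))]
    · unfold F1
      refine Finset.sum_congr rfl (fun r hr => ?_)
      simp at hr
      unfold dh
      rw [if_pos ⟨by omega, by omega⟩, Nat.sub_zero]
    · intro r hr
      simp at hr
      unfold dh
      rw [if_neg (by omega), zero_mul]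
  have hb : ∀ m, -(1024 * (1/2^m)) ≤ eta y := by
    intro m
    have hbd : ∀ r, ‖ee r * exp (-(2^r*y)) - dh m 0 r * exp (-(2^r*y))‖ ≤ 512 * (1/2^m) * (1/2^r) := by
      intro r
      have h1 : exp (-(2^r*y)) ≤ 1 := exp_le_one_iff.2 (by
        have : 0 ≤ 2^r*y := by positivity
        linarith)
      rw [← sub_mul, norm_mul, norm_eq_abs, norm_eq_abs, abs_of_pos (exp_pos _)]
      have := dh_bd m 0 r
      calc _ ≤ 512/(2:ℝ)^r * (2^0/2^m) * 1 := by gcongr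
        _ = _ := by field_simp
    have hs : Summable (fun r => ee r * exp (-(2^r*y)) - dh m 0 r * exp (-(2^r*y))) :=
      Summable.of_norm_bounded (geo2.summable.mul_left _) hbd
    have h2 := tsum_of_norm_bounded (geo2.mul_left (512 * (1/2^m))) hbd
    have h3 : F1 m y = eta y - ∑' r, (ee r * exp (-(2^r*y)) - dh m 0 r * exp (-(2^r*y))) := by
      rw [hF, eta, ← (eta_summ y hy).tsum_sub hs]
      exact tsum_congr (fun r => by ring)
    have h4 := F1_nonneg m y hy
    rw [norm_eq_abs] at h2
    have := (abs_le.1 h2).1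
    linarith
  have ht : Tendsto (fun m : ℕ => -(1024 * ((1:ℝ)/2^m))) atTop (nhds 0) := by
    have := (geo2.summable.tendsto_atTop_zero.const_mul 1024).neg
    simpa using this
  exact le_of_tendsto' ht hb

lemma ee_rec (r : ℕ) : ee (r+1) * (1 - 2^(r+1)) = 2 * ee r := by
  unfold ee
  have hq := Q_succ r
  have h1 := (Q_pos r).ne'
  have h2 := (Q_pos (r+1)).ne'
  have h3 := Qinf_pos.ne'
  have hc : (r+1).choose 2 = r + r.choose 2 := by
    rw [Nat.choose_succ_succ' r 1, Nat.choose_one_right]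
  have hp : (1:ℝ) - 1/2^(r+1) ≠ 0 := by
    intro h; rw [hq, h, mul_zero] at h2; exact h2 rfl
  have e : (1:ℝ) - 2^(r+1) = -(2^(r+1) * (1 - 1/2^(r+1))) := by field_simp; ring
  rw [hq, hc, e, pow_add 2 r, pow_succ (-1:ℝ)]
  generalize (1:ℝ) - 1/2^(r+1) = p at *
  rw [pow_succ 2]
  field_simp

lemma eta_deriv (y : ℝ) (hy : 0 < y) : HasDerivAt eta (2 * eta (2*y) - eta y) y := by
  have hd : HasDerivAt eta (∑' r : ℕ, ee r * (-2^r * exp (-(2^r*y)))) y := by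
    have ht : ∀ r : ℕ, ∀ y ∈ Set.Ioi (0:ℝ), ‖ee r * (-2^r * exp (-(2^r*y)))‖ ≤ 128 * (1/2^r) := by
      intro r y hy
      simp at hy
      have h1 : exp (-(2^r*y)) ≤ 1 := exp_le_one_iff.2 (by
        have : 0 ≤ 2^r*y := by positivity
        linarith)
      have h4 : (4:ℝ)^r = 2^r*2^r := by rw [← mul_pow]; norm_num
      have h3 := ee_bd r
      rw [norm_mul, norm_mul, norm_neg, norm_pow, norm_eq_abs, norm_eq_abs, norm_eq_abs, abs_of_pos (exp_pos _), abs_two]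
      calc _ ≤ 128/(4:ℝ)^r * (2^r * 1) := by gcongr
        _ = _ := by rw [h4]; field_simp
    exact hasDerivAt_tsum_of_isPreconnected (t := Set.Ioi (0:ℝ)) (y₀ := y)
      (g := fun (r:ℕ) (y:ℝ) => ee r * exp (-(2^r*y)))
      (g' := fun (r:ℕ) (y:ℝ) => ee r * (-2^r * exp (-(2^r*y))))
      (geo2.summable.mul_left 128) isOpen_Ioi isPreconnected_Ioi
      (fun r y _ => (expd (2^r) y).const_mul (ee r)) ht hy (eta_summ y hy.le) hy
  refine hd.congr_deriv ?_
  have hs : Summable (fun r : ℕ => ee r * (-2^r * exp (-(2^r*y)))) := by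
    refine Summable.of_norm_bounded (geo2.summable.mul_left 128) (fun r => ?_)
    have h1 : exp (-(2^r*y)) ≤ 1 := exp_le_one_iff.2 (by
        have : 0 ≤ 2^r*y := by positivity
        linarith)
    have h4 : (4:ℝ)^r = 2^r*2^r := by rw [← mul_pow]; norm_num
    have h3 := ee_bd r
    rw [norm_mul, norm_mul, norm_neg, norm_pow, norm_eq_abs, norm_eq_abs, norm_eq_abs, abs_of_pos (exp_pos _), abs_two]
    calc _ ≤ 128/(4:ℝ)^r * (2^r * 1) := by gcongr
      _ = _ := by rw [h4]; field_simp
  rw [eq_sub_iff_add_eq, eta, eta, ← hs.tsum_add (eta_summ y hy.le), ← tsum_mul_left]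
  rw [(hs.add (eta_summ y hy.le)).tsum_eq_zero_add]
  simp only [pow_zero]
  rw [show ee 0 * (-1 * exp (-(1*y))) + ee 0 * exp (-(1*y)) = 0 by ring, zero_add]
  refine tsum_congr (fun r => ?_)
  rw [← mul_assoc 2, ← ee_rec, show 2^r*(2*y) = 2^(r+1)*y by ring]
  ring

lemma eta_step (y : ℝ) (hy : 0 < y) (h : eta y = 0) : eta (3/2*y) = 0 := by
  have hd : ∀ z, 0 < z → HasDerivAt (fun z => exp (-(-1*z)) * eta z) (2 * exp (-(-1*z)) * eta (2*z)) z := by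
    intro z hz
    refine ((expd (-1) z).mul (eta_deriv z hz)).congr_deriv ?_
    ring
  have hm : MonotoneOn (fun z => exp (-(-1*z)) * eta z) (Set.Ioi 0) := by
    apply monotoneOn_of_deriv_nonneg (convex_Ioi 0)
    · exact fun z hz => (hd z hz).continuousAt.continuousWithinAt
    · intro z hz
      rw [interior_Ioi] at hz
      exact (hd z hz).differentiableAt.differentiableWithinAt
    · intro z hz
      rw [interior_Ioi] at hz
      rw [(hd z hz).deriv]
      have hz' : 0 < z := hz
      have := eta_nonneg (2*z) (by linarith)
      positivity
  have hz : ∀ z, 0 < z → z ≤ y → eta z = 0 := by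
    intro z h0 h1
    have h2 := hm (Set.mem_Ioi.2 h0) (Set.mem_Ioi.2 hy) h1
    simp only [h, mul_zero] at h2
    have h3 := eta_nonneg z h0.le
    have h4 := exp_pos (-(-1*z))
    nlinarith
  have hev : eta =ᶠ[nhds (3/4*y)] fun _ => 0 := by
    filter_upwards [Ioo_mem_nhds (show 0 < 3/4*y by linarith) (show 3/4*y < y by linarith)] with z hz'
    exact hz z hz'.1 hz'.2.le
  have h1 := eta_deriv (3/4*y) (by linarith)
  have h2 := (hasDerivAt_const (3/4*y) (0:ℝ)).congr_of_eventuallyEq hev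
  have h3 := h1.unique h2
  rw [hz (3/4*y) (by linarith) (by linarith)] at h3
  rw [show 3/2*y = 2*(3/4*y) by ring]
  linarith

lemma eta_large (y : ℝ) (hy : 256 < y) : 0 < eta y := by
  unfold eta
  rw [(eta_summ y (by linarith)).tsum_eq_zero_add]
  have hb : ∀ r : ℕ, ‖ee (r+1) * exp (-(2^(r+1)*y))‖ ≤ 32 * exp (-(2*y)) * (1/2^r) := by
    intro r
    have h1 : exp (-(2^(r+1)*y)) ≤ exp (-(2*y)) := by
      apply exp_le_exp.2
      have : (1:ℝ) ≤ 2^r := one_le_pow₀ (by norm_num)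
      rw [pow_succ]; nlinarith
    have h4 : (4:ℝ)^(r+1) = 2^r*2^r*4 := by rw [← mul_pow, pow_succ]; norm_num
    have h3 := ee_bd (r+1)
    rw [norm_mul, norm_eq_abs, norm_eq_abs, abs_of_pos (exp_pos _)]
    have h2 := pow_four_le r
    calc _ ≤ 128/(4:ℝ)^(r+1) * exp (-(2*y)) := by gcongr
      _ = 32 * exp (-(2*y)) * (1/(2^r*2^r)) := by rw [h4]; field_simp; norm_num
      _ ≤ _ := by gcongr
  have h2 := tsum_of_norm_bounded (geo2.mul_left (32 * exp (-(2*y)))) hb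
  rw [norm_eq_abs] at h2
  have h3 := (abs_le.1 h2).1
  have h4 : 1 ≤ ee 0 := by
    unfold ee
    have h5 := Qinf_le 0
    rw [Q_zero] at h5
    simp [Q_zero]
    exact (one_le_inv₀ Qinf_pos).2 h5
  have h5 : exp (-(2*y)) = exp (-y) * exp (-y) := by rw [← exp_add]; congr 1; ring
  have h6 : y * exp (-y) ≤ 1 := by
    have h := add_one_le_exp y
    have : exp y * exp (-y) = 1 := by rw [← exp_add]; simp
    have := exp_pos (-y)
    nlinarith
  have h7 := exp_pos (-y)
  have h8 : 256 * exp (-y) ≤ 1 := by nlinarith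
  rw [h5] at h3
  simp only [pow_zero, one_mul]
  nlinarith

lemma eta_pos (y : ℝ) (hy : 0 < y) : 0 < eta y := by
  rcases (eta_nonneg y hy.le).lt_or_eq with h | h
  · exact h
  · exfalso
    have hi : ∀ n : ℕ, eta ((3/2)^n*y) = 0 := by
      intro n
      induction n with
      | zero => simpa using h.symm
      | succ n ih =>
        have := eta_step _ (by positivity) ih
        rwa [← mul_assoc, ← pow_succ'] at this
    obtain ⟨n, hn⟩ := pow_unbounded_of_one_lt (256/y) (show (1:ℝ) < 3/2 by norm_num)
    rw [div_lt_iff₀ hy] at hn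
    have := eta_large _ hn
    rw [hi n] at this
    exact lt_irrefl _ this

lemma eta_cont : ContinuousOn eta (Set.Ici 0) := by
  apply continuousOn_tsum (u := fun r : ℕ => 128 * ((1:ℝ)/2^r))
  · intro r; fun_prop
  · exact geo2.summable.mul_left 128
  · intro r y hy; exact eta_term y hy r

lemma inner_TT (x : ℝ) (hx : 0 ≤ x) (j : ℕ) :
    ∑' r, TT x j r = 1/2^j * ∫ t in (0:ℝ)..x, gg j t * eta (2^j*(x-t)) := by
  unfold TT
  rw [tsum_mul_left]
  congr 1
  have hg := gg_cont j
  have h := intervalIntegral.hasSum_integral_of_dominated_convergence (μ := MeasureTheory.volume)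
    (a := 0) (b := x)
    (F := fun (r:ℕ) (t:ℝ) => ee r * (gg j t * exp (-(2^(r+j)*(x-t)))))
    (f := fun t => gg j t * eta (2^j*(x-t)))
    (fun (r:ℕ) (_:ℝ) => 65536 * (128 * ((1:ℝ)/2^r)))
    (fun r => Continuous.aestronglyMeasurable (by fun_prop))
    (fun r => Filter.Eventually.of_forall (fun t ht => ?_))
    (Filter.Eventually.of_forall (fun t _ => (geo2.summable.mul_left 128).mul_left 65536))
    (by simp)
    (Filter.Eventually.of_forall (fun t ht => ?_))
  · rw [← h.tsum_eq]
    refine tsum_congr (fun r => ?_)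
    rw [Ph_conv, intervalIntegral.integral_const_mul]
  · rw [Set.uIoc_of_le hx] at ht
    have h1 := gg_nonneg j t ht.1.le
    have h2 := gg_bd j t ht.1.le
    have h3 := eta_term (2^j*(x-t)) (mul_nonneg (by positivity) (by linarith [ht.2])) r
    rw [show ee r * (gg j t * exp (-(2^(r+j)*(x-t)))) = gg j t * (ee r * exp (-(2^r*(2^j*(x-t))))) by
      rw [pow_add, mul_assoc]; ring, norm_mul, norm_eq_abs, abs_of_nonneg h1]
    gcongr
  · rw [Set.uIoc_of_le hx] at ht
    have h3 := (eta_summ (2^j*(x-t)) (mul_nonneg (by positivity) (by linarith [ht.2]))).hasSum.mul_left (gg j t)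
    refine hasSum_of_eq h3 (fun r => ?_) rfl
    rw [pow_add, mul_assoc (2^r)]; ring

lemma GI_pos (x : ℝ) (hx : 0 < x) : 0 < GI x := by
  rw [GI_eq]
  refine (TT_summ2 x hx.le).tsum_pos (fun j => ?_) 0 ?_
  · rw [inner_TT x hx.le]
    refine mul_nonneg (by positivity) (intervalIntegral.integral_nonneg hx.le (fun t ht => ?_))
    exact mul_nonneg (gg_nonneg j t ht.1) (eta_nonneg _ (mul_nonneg (by positivity) (by linarith [ht.2])))
  · rw [inner_TT x hx.le]
    refine mul_pos (by positivity) (intervalIntegral.intervalIntegral_pos_of_pos_on ?_ (fun t ht => ?_) hx)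
    · apply ContinuousOn.intervalIntegrable
      rw [Set.uIcc_of_le hx.le]
      refine (gg_cont 0).continuousOn.mul (eta_cont.comp (by fun_prop) (fun t ht => ?_))
      simp; exact ht.2
    · refine mul_pos ?_ (eta_pos _ (mul_pos (by positivity) (by linarith [ht.2])))
      unfold gg
      rw [F20, neg_sq]
      exact mul_pos ht.1 (pow_pos (exp_pos (-t)) 2)

/-- `G_I` is positive on `(0,∞)` and
`Var(I_{n,k}) = 2^k G_I(2^{-k} n) + O(1)` uniformly for `0 ≤ k < n`. -/
theorem variance_internal_profile :
    (∀ x : ℝ, 0 < x → 0 < GI x) ∧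
    ∃ C > (0:ℝ), ∀ n k : ℕ, 1 ≤ n → k < n →
      |(nuI n k - (lam n k)^2) - (2:ℝ)^k * GI ((2:ℝ)^(-(k:ℤ)) * n)| ≤ C := by
  refine ⟨GI_pos, 2^22 + 3*768^2 + 65536*512*4, by norm_num, fun n k _ _ => ?_⟩
  have e : (2:ℝ)^(-(k:ℤ)) * n = n/2^k := by rw [zpow_neg, zpow_natCast]; field_simp
  rw [e]
  have h1 := vv_WW n k
  have h2 := GI_WW (n/2^k) (by positivity) k
  have h3 : |2^k * GI (n/2^k) - 2^k * WW k (n/2^k)| ≤ 65536*512*4 := by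
    rw [← mul_sub, abs_mul, abs_of_pos (by positivity)]
    calc _ ≤ (2:ℝ)^k * (65536 * 512 * 4 * (1/2^k)) := by gcongr
      _ = _ := by field_simp
  unfold vv at h1
  rw [abs_le] at h1 h3 ⊢
  constructor <;> linarith [h1.1, h1.2, h3.1, h3.2]
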